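/- arXiv:2504.02336 — 2 statements merged into one kernel-verified Lean document; each statement's English description precedes it below -/
import Mathlib

section
/- For each pair γ, ρ ∈ {1,2,3} there exists a continuously differentiable function h_{γρ} : ℝ³ → ℝ such that for every smooth compactly supported function φ : ℝ³ → ℂ one has (1/(2π)³) ∫_{ℝ³} ( ξ_γ ξ_ρ / (1+|ξ|²)^{5/2} ) ( ∫_{ℝ³} e^{−i⟨y,ξ⟩} φ(y) dy ) dξ = ∫_{ℝ³} ( −(1/(12π²)) [ 2 y_γ y_ρ/|y|² + (1 + 2 ln|y|) δ_{γρ} ] + h_{γρ}(y) ) φ(y) dy, where both iterated integrals converge absolutely. -/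
open MeasureTheory
open scoped RealInnerProductSpace

noncomputable section

namespace FTS

open Set Filter Topology

/-- exponential beats powers -/
lemma exp_bound (p : ℝ) (hp : 0 ≤ p) :
    ∃ C : ℝ, 0 < C ∧ ∀ s t : ℝ, 0 < s → 0 < t →
      Real.exp (-(s / (4 * t))) ≤ C * (s ^ (-p) * t ^ p) := by
  obtain ⟨n, hn⟩ := exists_nat_ge p
  refine ⟨(1 + n.factorial) * 4 ^ p, by positivity, fun s t hs ht => ?_⟩
  set x := s / (4 * t) with hx
  have hx0 : 0 < x := by positivity
  have h1 : x ^ p ≤ 1 + x ^ n := by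
    rcases le_total x 1 with h | h
    · have := Real.rpow_le_one hx0.le h hp
      have : 0 ≤ x ^ n := by positivity
      linarith
    · have : x ^ p ≤ x ^ (n : ℝ) := Real.rpow_le_rpow_of_exponent_le h hn
      rw [Real.rpow_natCast] at this
      linarith
  have h2 : x ^ n ≤ n.factorial * Real.exp x := by
    have := Real.pow_div_factorial_le_exp x hx0.le n
    rw [div_le_iff₀ (by positivity)] at this
    linarith
  have h3 : x ^ p ≤ (1 + n.factorial) * Real.exp x := by
    have : 1 ≤ Real.exp x := Real.one_le_exp hx0.le
    linarith
  have h4 : (1 + n.factorial) * 4 ^ p * (s ^ (-p) * t ^ p) = (1 + n.factorial) * (x ^ p)⁻¹ := by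
    rw [hx, Real.div_rpow hs.le (by positivity), Real.mul_rpow (by norm_num) ht.le,
      Real.rpow_neg hs.le]
    field_simp
  rw [h4, Real.exp_neg, ← div_eq_mul_inv, inv_eq_one_div,
    div_le_div_iff₀ (Real.exp_pos _) (by positivity)]
  linarith

/-- the basic integrable weight -/
def w (t : ℝ) : ℝ := (1 - Real.exp (-t)) * t ^ (-(7 / 4) : ℝ)

lemma q_nonneg {t : ℝ} (ht : 0 < t) : 0 ≤ 1 - Real.exp (-t) := by
  have : Real.exp (-t) ≤ 1 := Real.exp_le_one_iff.2 (by linarith)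
  linarith

lemma q_le {t : ℝ} : 1 - Real.exp (-t) ≤ t := by
  have := Real.add_one_le_exp (-t)
  linarith

lemma q_le_one {t : ℝ} : 1 - Real.exp (-t) ≤ 1 := by
  have := Real.exp_pos (-t)
  linarith

lemma q_le_rpow {t : ℝ} (ht : 0 < t) : 1 - Real.exp (-t) ≤ t ^ (3 / 4 : ℝ) := by
  rcases le_total t 1 with h | h
  · refine q_le.trans ?_
    simpa using Real.rpow_le_rpow_of_exponent_ge ht h (by norm_num : (3 / 4 : ℝ) ≤ 1)
  · exact q_le_one.trans (Real.one_le_rpow h (by norm_num))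

lemma w_nonneg {t : ℝ} (ht : 0 < t) : 0 ≤ w t :=
  mul_nonneg (q_nonneg ht) (by positivity)

lemma w_meas : Measurable w := by unfold w; fun_prop

lemma w_int : IntegrableOn w (Ioi 0) := by
  rw [← Ioc_union_Ioi_eq_Ioi (zero_le_one' ℝ)]
  refine IntegrableOn.union ?_ ?_
  · have h : IntegrableOn (fun t : ℝ => t ^ (-(3 / 4) : ℝ)) (Ioc 0 1) := by
      have := intervalIntegral.intervalIntegrable_rpow' (a := 0) (b := 1)
        (r := -(3 / 4)) (by norm_num)
      rwa [intervalIntegrable_iff_integrableOn_Ioc_of_le zero_le_one] at this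
    refine Integrable.mono' h w_meas.aestronglyMeasurable ?_
    refine (ae_restrict_iff' measurableSet_Ioc).2 (Eventually.of_forall fun t ht => ?_)
    rw [Real.norm_of_nonneg (w_nonneg ht.1)]
    have : t ^ (-(3 / 4) : ℝ) = t * t ^ (-(7 / 4) : ℝ) := by
      rw [← Real.rpow_one_add' ht.1.le (by norm_num)]; norm_num
    rw [this]
    exact mul_le_mul_of_nonneg_right q_le (by have := ht.1; positivity)
  · have h : IntegrableOn (fun t : ℝ => t ^ (-(7 / 4) : ℝ)) (Ioi 1) :=
      integrableOn_Ioi_rpow_of_lt (by norm_num) one_pos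
    refine Integrable.mono' h w_meas.aestronglyMeasurable ?_
    refine (ae_restrict_iff' measurableSet_Ioi).2 (Eventually.of_forall fun t ht => ?_)
    have ht0 : (0 : ℝ) < t := lt_trans one_pos ht
    rw [Real.norm_of_nonneg (w_nonneg ht0)]
    calc w t ≤ 1 * t ^ (-(7 / 4) : ℝ) :=
          mul_le_mul_of_nonneg_right q_le_one (by positivity)
      _ = _ := one_mul _

/-- differentiation under the integral -/
lemma deriv_lemma (F : ℝ → ℝ → ℝ) (g : ℝ → ℝ) (hFm : ∀ s, Measurable (F s))
    (hF : ∀ s, 0 < s → IntegrableOn (F s) (Ioi 0))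
    (hgi : ∀ s, 0 < s → IntegrableOn (fun t => Real.exp (-(s / (4 * t))) * g t) (Ioi 0))
    (hd : ∀ s t, 0 < s → 0 < t → HasDerivAt (fun s => F s t) (Real.exp (-(s / (4 * t))) * g t) s)
    (s : ℝ) (hs : 0 < s) :
    HasDerivAt (fun s => ∫ t in Ioi 0, F s t)
      (∫ t in Ioi 0, Real.exp (-(s / (4 * t))) * g t) s := by
  refine (hasDerivAt_integral_of_dominated_loc_of_deriv_le
    (F' := fun s t => Real.exp (-(s / (4 * t))) * g t)
    (bound := fun t => ‖Real.exp (-((s/2) / (4 * t))) * g t‖) (s := Ioi (s/2))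
    (Ioi_mem_nhds (by linarith)) (Eventually.of_forall fun s => (hFm s).aestronglyMeasurable)
    (hF s hs) (hgi s hs).aestronglyMeasurable ?_ (hgi (s/2) (by linarith)).norm ?_).2
  · refine (ae_restrict_iff' measurableSet_Ioi).2 (Eventually.of_forall fun t ht x hx => ?_)
    rw [norm_mul, norm_mul]
    refine mul_le_mul_of_nonneg_right ?_ (norm_nonneg _)
    rw [Real.norm_of_nonneg (Real.exp_pos _).le, Real.norm_of_nonneg (Real.exp_pos _).le,
      Real.exp_le_exp, neg_le_neg_iff]
    have : (0:ℝ) < t := ht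
    have : s/2 < x := hx
    gcongr
  · refine (ae_restrict_iff' measurableSet_Ioi).2 (Eventually.of_forall fun t ht x hx => ?_)
    exact hd x t (lt_trans (by linarith) hx) ht

/-- moments -/
def M (k : ℕ) (s : ℝ) : ℝ :=
  ∫ t in Ioi (0:ℝ), Real.exp (-(s / (4 * t))) * ((1 - Real.exp (-t)) / t ^ k)

lemma M_pt (k : ℕ) (hk : 2 ≤ k) : ∃ C : ℝ, 0 < C ∧ ∀ s t : ℝ, 0 < s → 0 < t →
    ‖Real.exp (-(s / (4 * t))) * ((1 - Real.exp (-t)) / t ^ k)‖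
      ≤ C * s ^ ((7 / 4 : ℝ) - k) * w t := by
  have hk' : (2 : ℝ) ≤ k := by exact_mod_cast hk
  obtain ⟨C, hC, h⟩ := exp_bound (k - 7 / 4) (by linarith)
  refine ⟨C, hC, fun s t hs ht => ?_⟩
  have hq := q_nonneg ht
  rw [Real.norm_of_nonneg (by positivity)]
  calc _ ≤ (C * (s ^ (-(k - 7 / 4 : ℝ)) * t ^ (k - 7 / 4 : ℝ))) * ((1 - Real.exp (-t)) / t ^ k) :=
        mul_le_mul_of_nonneg_right (h s t hs ht) (by positivity)
    _ = _ := by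
        rw [neg_sub, sub_eq_add_neg (k:ℝ), Real.rpow_add ht, Real.rpow_natCast, w]
        field_simp

lemma M_int (k : ℕ) (hk : 2 ≤ k) (s : ℝ) (hs : 0 < s) :
    IntegrableOn (fun t : ℝ => Real.exp (-(s / (4 * t))) * ((1 - Real.exp (-t)) / t ^ k))
      (Ioi 0) := by
  obtain ⟨C, hC, h⟩ := M_pt k hk
  refine Integrable.mono' (w_int.const_mul (C * s ^ ((7 / 4 : ℝ) - k)))
    (Measurable.aestronglyMeasurable (by fun_prop)) ?_
  exact (ae_restrict_iff' measurableSet_Ioi).2 (Eventually.of_forall fun t ht => h s t hs ht)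

lemma M_bound (k : ℕ) (hk : 2 ≤ k) :
    ∃ C : ℝ, 0 ≤ C ∧ ∀ s : ℝ, 0 < s → |M k s| ≤ C * s ^ ((7 / 4 : ℝ) - k) := by
  obtain ⟨C, hC, h⟩ := M_pt k hk
  have hw : 0 ≤ ∫ t in Ioi (0:ℝ), w t := setIntegral_nonneg measurableSet_Ioi fun t ht => w_nonneg ht
  refine ⟨C * ∫ t in Ioi (0:ℝ), w t, by positivity, fun s hs => ?_⟩
  have := norm_integral_le_of_norm_le (μ := volume.restrict (Ioi 0))
    (w_int.const_mul (C * s ^ ((7 / 4 : ℝ) - k)))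
    ((ae_restrict_iff' measurableSet_Ioi).2 (Eventually.of_forall fun t ht => h s t hs ht))
  rw [integral_const_mul] at this
  calc |M k s| ≤ _ := this
    _ = _ := by ring

lemma hasDerivAt_expo (s t : ℝ) : HasDerivAt (fun s : ℝ => Real.exp (-(s / (4 * t))))
    (Real.exp (-(s / (4 * t))) * (-(1 / (4 * t)))) s :=
  (((hasDerivAt_id s).div_const (4 * t)).neg).exp

lemma M_deriv (k : ℕ) (hk : 2 ≤ k) (s : ℝ) (hs : 0 < s) :
    HasDerivAt (M k) (-(1 / 4) * M (k + 1) s) s := by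
  have := deriv_lemma
    (fun s t => Real.exp (-(s / (4 * t))) * ((1 - Real.exp (-t)) / t ^ k))
    (fun t => -(1 / 4) * ((1 - Real.exp (-t)) / t ^ (k + 1)))
    (fun s => by fun_prop) (M_int k hk) ?_ ?_ s hs
  · convert! this using 1
    rw [M, ← integral_const_mul]
    congr 1; ext t; ring
  · intro s hs
    have := (M_int (k+1) (by omega) s hs).const_mul (-(1/4))
    refine this.congr (Eventually.of_forall fun t => ?_)
    simp only; ring
  · intro s t hs ht
    convert! (hasDerivAt_expo s t).mul_const ((1 - Real.exp (-t)) / t ^ k) using 1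
    field_simp
    ring

def P (s : ℝ) : ℝ :=
  ∫ t in Ioi (0:ℝ), (1 - Real.exp (-(s / (4 * t)))) * ((1 - Real.exp (-t)) / t)

lemma P_pt (s t : ℝ) (hs : 0 < s) (ht : 0 < t) :
    ‖(1 - Real.exp (-(s / (4 * t)))) * ((1 - Real.exp (-t)) / t)‖ ≤ s ^ (3 / 4 : ℝ) * w t := by
  have hq := q_nonneg ht
  have hx : 0 < s / (4 * t) := by positivity
  have hq' := q_nonneg hx
  rw [Real.norm_of_nonneg (by positivity)]
  have h1 : 1 - Real.exp (-(s / (4 * t))) ≤ s ^ (3 / 4 : ℝ) * t ^ (-(3 / 4) : ℝ) := by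
    refine (q_le_rpow hx).trans ?_
    rw [Real.rpow_neg ht.le, ← div_eq_mul_inv, ← Real.div_rpow hs.le ht.le]
    gcongr
    linarith
  calc _ ≤ s ^ (3 / 4 : ℝ) * t ^ (-(3 / 4) : ℝ) * ((1 - Real.exp (-t)) / t) :=
        mul_le_mul_of_nonneg_right h1 (by positivity)
    _ = _ := by
      have : t ^ (-(3 / 4) : ℝ) = t * t ^ (-(7 / 4) : ℝ) := by
        rw [← Real.rpow_one_add' ht.le (by norm_num)]; norm_num
      rw [this, w]; field_simp

lemma P_int (s : ℝ) (hs : 0 < s) :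
    IntegrableOn (fun t : ℝ => (1 - Real.exp (-(s / (4 * t)))) * ((1 - Real.exp (-t)) / t))
      (Ioi 0) := by
  refine Integrable.mono' (w_int.const_mul (s ^ (3 / 4 : ℝ)))
    (Measurable.aestronglyMeasurable (by fun_prop)) ?_
  exact (ae_restrict_iff' measurableSet_Ioi).2 (Eventually.of_forall fun t ht => P_pt s t hs ht)

lemma P_bound : ∃ C : ℝ, 0 ≤ C ∧ ∀ s : ℝ, 0 < s → |P s| ≤ C * s ^ (3 / 4 : ℝ) := by
  have hw : 0 ≤ ∫ t in Ioi (0:ℝ), w t := setIntegral_nonneg measurableSet_Ioi fun t ht => w_nonneg ht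
  refine ⟨∫ t in Ioi (0:ℝ), w t, by positivity, fun s hs => ?_⟩
  have := norm_integral_le_of_norm_le (μ := volume.restrict (Ioi 0))
    (w_int.const_mul (s ^ (3 / 4 : ℝ)))
    ((ae_restrict_iff' measurableSet_Ioi).2 (Eventually.of_forall fun t ht => P_pt s t hs ht))
  rw [integral_const_mul] at this
  calc |P s| ≤ _ := this
    _ = _ := by ring

lemma P_zero : P 0 = 0 := by simp [P]

lemma P_deriv (s : ℝ) (hs : 0 < s) : HasDerivAt P (1 / 4 * M 2 s) s := by
  have := deriv_lemma
    (fun s t => (1 - Real.exp (-(s / (4 * t)))) * ((1 - Real.exp (-t)) / t))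
    (fun t => (1 / 4) * ((1 - Real.exp (-t)) / t ^ 2))
    (fun s => by fun_prop) P_int ?_ ?_ s hs
  · convert! this using 1
    rw [M, ← integral_const_mul]
    congr 1; ext t; ring
  · intro s hs
    have := (M_int 2 (by omega) s hs).const_mul (1/4)
    refine this.congr (Eventually.of_forall fun t => ?_)
    simp only; ring
  · intro s t hs ht
    convert! ((hasDerivAt_expo s t).const_sub 1).mul_const ((1 - Real.exp (-t)) / t) using 1
    field_simp

/-- Bessel-type integrals -/
def A (k : ℕ) (s : ℝ) : ℝ :=
  ∫ t in Ioi (0:ℝ), Real.exp (-(s / (4 * t))) * (Real.exp (-t) / t ^ k)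

lemma A_int (k : ℕ) (s : ℝ) (hs : 0 < s) :
    IntegrableOn (fun t : ℝ => Real.exp (-(s / (4 * t))) * (Real.exp (-t) / t ^ k)) (Ioi 0) := by
  obtain ⟨C, hC, h⟩ := exp_bound k (by positivity)
  have he : IntegrableOn (fun t : ℝ => Real.exp (-t)) (Ioi 0) := by
    simpa using exp_neg_integrableOn_Ioi 0 one_pos
  refine Integrable.mono' (he.const_mul (C * s ^ (-(k:ℝ))))
    (Measurable.aestronglyMeasurable (by fun_prop)) ?_
  refine (ae_restrict_iff' measurableSet_Ioi).2 (Eventually.of_forall fun t ht => ?_)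
  have ht : 0 < t := ht
  rw [Real.norm_of_nonneg (by positivity)]
  calc _ ≤ (C * (s ^ (-(k:ℝ)) * t ^ (k:ℝ))) * (Real.exp (-t) / t ^ k) :=
        mul_le_mul_of_nonneg_right (h s t hs ht) (by positivity)
    _ = _ := by
        rw [Real.rpow_natCast]
        field_simp

lemma A_deriv (k : ℕ) (s : ℝ) (hs : 0 < s) :
    HasDerivAt (A k) (-(1 / 4) * A (k + 1) s) s := by
  have := deriv_lemma
    (fun s t => Real.exp (-(s / (4 * t))) * (Real.exp (-t) / t ^ k))
    (fun t => -(1 / 4) * (Real.exp (-t) / t ^ (k + 1)))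
    (fun s => by fun_prop) (A_int k) ?_ ?_ s hs
  · convert! this using 1
    rw [A, ← integral_const_mul]
    congr 1; ext t; ring
  · intro s hs
    have := (A_int (k+1) s hs).const_mul (-(1/4))
    refine this.congr (Eventually.of_forall fun t => ?_)
    simp only; ring
  · intro s t hs ht
    convert! (hasDerivAt_expo s t).mul_const (Real.exp (-t) / t ^ k) using 1
    field_simp
    ring

/-- an explicit exponential integral -/
lemma int_inv (s : ℝ) (hs : 0 < s) : IntegrableOn
    (fun t : ℝ => Real.exp (-(s / (4 * t))) * (1 / t ^ 2)) (Ioi 0) ∧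
    ∫ t in Ioi (0:ℝ), Real.exp (-(s / (4 * t))) * (1 / t ^ 2) = 4 / s := by
  let G : ℝ → ℝ := fun t => if t ≤ 0 then 0 else 4 / s * Real.exp (-(s / (4 * t)))
  have hG : ∀ t, 0 < t → G t = 4 / s * Real.exp (-(s / (4 * t))) := fun t ht => by
    simp [G, not_le.2 ht]
  have hd : ∀ t ∈ Ioi (0:ℝ), HasDerivAt G (Real.exp (-(s / (4 * t))) * (1 / t ^ 2)) t := by
    intro t ht
    have ht : 0 < t := ht
    have h1 : HasDerivAt (fun t : ℝ => 4 / s * Real.exp (-(s / (4 * t))))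
        (4 / s * (Real.exp (-(s / (4 * t))) * (-((0 * (4 * t) - s * (4 * 1)) / (4 * t) ^ 2)))) t := by
      refine HasDerivAt.const_mul _ (HasDerivAt.exp (HasDerivAt.neg ?_))
      exact (hasDerivAt_const t s).div ((hasDerivAt_id t).const_mul 4) (by positivity)
    refine HasDerivAt.congr_of_eventuallyEq (f := fun t : ℝ => 4 / s * Real.exp (-(s / (4 * t))))
      ?_ ?_
    · convert! h1 using 1
      field_simp
      ring
    · filter_upwards [Ioi_mem_nhds ht] with x hx using hG x hx
  have hG0 : G 0 = 0 := by simp [G]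
  have hc : ContinuousWithinAt G (Ici 0) 0 := by
    rw [← Ioi_insert, continuousWithinAt_insert_self, ContinuousWithinAt, hG0]
    have : Tendsto (fun t : ℝ => 4 / s * Real.exp (-(s / (4 * t)))) (𝓝[>] 0) (𝓝 (4 / s * 0)) := by
      refine Tendsto.const_mul _ (Real.tendsto_exp_atBot.comp (tendsto_neg_atTop_atBot.comp ?_))
      have : Tendsto (fun t : ℝ => s / 4 * t⁻¹) (𝓝[>] 0) atTop :=
        tendsto_inv_nhdsGT_zero.const_mul_atTop (by positivity)
      refine this.congr fun t => ?_
      rw [← div_div, div_eq_mul_inv (s / 4)]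
    rw [mul_zero] at this
    refine this.congr' ?_
    filter_upwards [self_mem_nhdsWithin] with t ht using (hG t ht).symm
  have hl : Tendsto G atTop (𝓝 (4 / s)) := by
    have : Tendsto (fun t : ℝ => 4 / s * Real.exp (-(s / (4 * t)))) atTop
        (𝓝 (4 / s * Real.exp (-0))) := by
      refine Tendsto.const_mul _ (Tendsto.rexp (Tendsto.neg ?_))
      exact Tendsto.const_div_atTop (tendsto_id.const_mul_atTop (by norm_num)) s
    rw [neg_zero, Real.exp_zero, mul_one] at this
    refine this.congr' ?_
    filter_upwards [Ioi_mem_atTop 0] with t ht using (hG t ht).symm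
  have hp : ∀ t ∈ Ioi (0:ℝ), 0 ≤ Real.exp (-(s / (4 * t))) * (1 / t ^ 2) :=
    fun t ht => by positivity
  refine ⟨integrableOn_Ioi_deriv_of_nonneg hc hd hp hl, ?_⟩
  rw [integral_Ioi_of_hasDerivAt_of_nonneg hc hd hp hl, hG0, sub_zero]

lemma A_two (s : ℝ) (hs : 0 < s) : A 2 s = 4 / s - M 2 s := by
  have h := int_inv s hs
  rw [← h.2, A, M, ← integral_sub h.1 (M_int 2 le_rfl s hs)]
  congr 1; ext t; ring

lemma A_one (s : ℝ) (hs : 0 < s) : A 1 s = A 1 1 - P 1 + P s - Real.log s := by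
  have key : ∀ x ∈ Ioi (0:ℝ), HasDerivAt (fun s => A 1 s - P s + Real.log s) 0 x := by
    intro x hx
    have hx : 0 < x := hx
    convert! ((A_deriv 1 x hx).sub (P_deriv x hx)).add (Real.hasDerivAt_log hx.ne') using 1
    rw [A_two x hx]; field_simp; ring
  have := (convex_Ioi (0:ℝ)).is_const_of_fderivWithin_eq_zero (𝕜 := ℝ)
    (f := fun s => A 1 s - P s + Real.log s)
    (fun x hx => (key x hx).differentiableAt.differentiableWithinAt)
    (fun x hx => by
      rw [fderivWithin_of_isOpen isOpen_Ioi hx]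
      ext; simp [(key x hx).deriv]) (x := s) (y := 1) hs (mem_Ioi.2 one_pos)
  simp at this
  linarith

end FTS


namespace FTS

open Set Filter Topology

local notation "E3" => EuclideanSpace ℝ (Fin 3)

lemma c1_lemma (f : E3 → ℝ) (f' : E3 → E3 →L[ℝ] ℝ) (h0 : f 0 = 0) (h0' : f' 0 = 0) (C C' : ℝ)
    (hd : ∀ x, x ≠ 0 → HasFDerivAt f (f' x) x) (hc : ∀ x, x ≠ 0 → ContinuousAt f' x)
    (hb : ∀ x, x ≠ 0 → |f x| ≤ C * ‖x‖ ^ (3 / 2 : ℝ))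
    (hb' : ∀ x, x ≠ 0 → ‖f' x‖ ≤ C' * ‖x‖ ^ (1 / 2 : ℝ)) : ContDiff ℝ 1 f := by
  rw [contDiff_one_iff_hasFDerivAt]
  have hn : Tendsto (fun x : E3 => ‖x‖ ^ (1 / 2 : ℝ)) (𝓝 0) (𝓝 0) := by
    have : Continuous (fun x : E3 => ‖x‖ ^ (1 / 2 : ℝ)) :=
      continuous_norm.rpow_const (fun _ => Or.inr (by norm_num))
    simpa using this.tendsto 0
  refine ⟨f', ?_, ?_⟩
  · rw [continuous_iff_continuousAt]
    intro x
    by_cases hx : x = 0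
    · subst hx
      rw [ContinuousAt, h0']
      refine squeeze_zero_norm (a := fun x => C' * ‖x‖ ^ (1 / 2 : ℝ)) (fun x => ?_) ?_
      · by_cases hx : x = 0
        · subst hx; simp [h0']
        · exact hb' x hx
      · simpa using hn.const_mul C'
    · exact hc x hx
  · intro x
    by_cases hx : x = 0
    · subst hx
      rw [h0', hasFDerivAt_iff_tendsto]
      refine squeeze_zero (g := fun x => C * ‖x‖ ^ (1 / 2 : ℝ)) (fun x => by positivity)
        (fun x => ?_) ?_
      · by_cases hx : x = 0
        · subst hx; simp
        · have hx' : 0 < ‖x‖ := norm_pos_iff.2 hx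
          simp only [h0, sub_zero, _root_.zero_apply, Real.norm_eq_abs]
          rw [inv_mul_le_iff₀ hx']
          refine (hb x hx).trans (le_of_eq ?_)
          have : ‖x‖ ^ (3 / 2 : ℝ) = ‖x‖ * ‖x‖ ^ (1 / 2 : ℝ) := by
            rw [← Real.rpow_one_add' hx'.le (by norm_num)]; norm_num
          rw [this]; ring
      · simpa using hn.const_mul C
    · exact hd x hx

lemma sq_rpow (x : E3) (a : ℝ) : (‖x‖ ^ 2) ^ a = ‖x‖ ^ (2 * a) := by
  rw [Real.rpow_mul (norm_nonneg _)]; norm_num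

lemma nsq_pos {x : E3} (hx : x ≠ 0) : 0 < ‖x‖ ^ 2 := by
  have := norm_pos_iff.2 hx
  positivity

lemma cont_M (k : ℕ) (hk : 2 ≤ k) (x : E3) (hx : x ≠ 0) :
    ContinuousAt (fun y : E3 => M k (‖y‖ ^ 2)) x :=
  ContinuousAt.comp (g := M k) (M_deriv k hk _ (nsq_pos hx)).continuousAt (by fun_prop)

lemma f1_c1 : ContDiff ℝ 1 (fun y : E3 => P (‖y‖ ^ 2)) := by
  obtain ⟨C, hC, hb⟩ := P_bound
  obtain ⟨C', hC', hb'⟩ := M_bound 2 le_rfl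
  refine c1_lemma _ (fun y => (1 / 4 * M 2 (‖y‖ ^ 2)) • (2 • innerSL ℝ y)) (by simp [P_zero])
    (by simp) C (C' / 2) ?_ ?_ ?_ ?_
  · intro x hx
    exact (P_deriv _ (nsq_pos hx)).comp_hasFDerivAt x (hasStrictFDerivAt_norm_sq x).hasFDerivAt
  · intro x hx
    have := cont_M 2 le_rfl x hx
    fun_prop
  · intro x hx
    have := hb _ (nsq_pos hx)
    rw [sq_rpow] at this
    norm_num at this ⊢
    exact this
  · intro x hx
    have hx' : 0 < ‖x‖ := norm_pos_iff.2 hx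
    have := hb' _ (nsq_pos hx)
    rw [sq_rpow] at this
    have e : ‖x‖ ^ (1 / 2 : ℝ) = ‖x‖ ^ (2 * (7 / 4 - (2:ℕ)) : ℝ) * ‖x‖ := by
      rw [← Real.rpow_add_one hx'.ne']; norm_num
    rw [e, norm_smul, two_smul]
    have h2 : ‖innerSL ℝ x + innerSL ℝ x‖ ≤ 2 * ‖x‖ :=
      (norm_add_le _ _).trans (by rw [innerSL_apply_norm]; linarith)
    calc _ ≤ (1 / 4 * (C' * ‖x‖ ^ (2 * (7 / 4 - (2:ℕ)) : ℝ))) * (2 * ‖x‖) := by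
          refine mul_le_mul ?_ h2 (norm_nonneg _) (by positivity)
          rw [norm_mul, Real.norm_of_nonneg (by norm_num : (0:ℝ) ≤ 1 / 4), Real.norm_eq_abs]
          exact mul_le_mul_of_nonneg_left this (by norm_num)
      _ = _ := by ring

lemma coord_le (γ : Fin 3) (x : E3) : |x γ| ≤ ‖x‖ := PiLp.norm_apply_le x γ

lemma proj_norm (γ : Fin 3) : ‖(EuclideanSpace.proj γ : E3 →L[ℝ] ℝ)‖ ≤ 1 :=
  ContinuousLinearMap.opNorm_le_bound _ zero_le_one fun x => by
    rw [one_mul]; exact coord_le γ x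

lemma f2_c1 (γ ρ : Fin 3) : ContDiff ℝ 1 (fun y : E3 => (y γ * y ρ) * M 2 (‖y‖ ^ 2)) := by
  obtain ⟨C, hC, hb⟩ := M_bound 2 le_rfl
  obtain ⟨C', hC', hb'⟩ := M_bound 3 (by norm_num)
  refine c1_lemma _ (fun y => (y γ * y ρ) • ((-(1 / 4) * M 3 (‖y‖ ^ 2)) • (2 • innerSL ℝ y)) +
    M 2 (‖y‖ ^ 2) • (y γ • (EuclideanSpace.proj ρ : E3 →L[ℝ] ℝ) +
      y ρ • (EuclideanSpace.proj γ : E3 →L[ℝ] ℝ))) (by simp)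
    (by simp) C (C' / 2 + 2 * C) ?_ ?_ ?_ ?_
  · intro x hx
    refine HasFDerivAt.mul ?_ ?_
    · exact (EuclideanSpace.proj γ : E3 →L[ℝ] ℝ).hasFDerivAt.mul
        (EuclideanSpace.proj ρ : E3 →L[ℝ] ℝ).hasFDerivAt
    · exact (M_deriv 2 le_rfl _ (nsq_pos hx)).comp_hasFDerivAt x
        (hasStrictFDerivAt_norm_sq x).hasFDerivAt
  · intro x hx
    have := cont_M 2 le_rfl x hx
    have := cont_M 3 (by norm_num) x hx
    fun_prop
  · intro x hx
    have hx' : 0 < ‖x‖ := norm_pos_iff.2 hx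
    have := hb _ (nsq_pos hx)
    rw [sq_rpow] at this
    have e : ‖x‖ ^ (3 / 2 : ℝ) = ‖x‖ ^ (2 * (7 / 4 - (2:ℕ)) : ℝ) * ‖x‖ * ‖x‖ := by
      rw [← Real.rpow_add_one hx'.ne', ← Real.rpow_add_one hx'.ne']; norm_num
    rw [e, abs_mul, abs_mul]
    calc _ ≤ (‖x‖ * ‖x‖) * (C * ‖x‖ ^ (2 * (7 / 4 - (2:ℕ)) : ℝ)) := by
          gcongr <;> exact coord_le _ x
      _ = _ := by ring
  · intro x hx
    have hx' : 0 < ‖x‖ := norm_pos_iff.2 hx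
    have h1 := hb _ (nsq_pos hx)
    have h2 := hb' _ (nsq_pos hx)
    rw [sq_rpow] at h1 h2
    have e1 : ‖x‖ ^ (1 / 2 : ℝ) = ‖x‖ ^ (2 * (7 / 4 - (2:ℕ)) : ℝ) * ‖x‖ := by
      rw [← Real.rpow_add_one hx'.ne']; norm_num
    have e2 : ‖x‖ ^ (1 / 2 : ℝ) = ‖x‖ ^ (2 * (7 / 4 - (3:ℕ)) : ℝ) * ‖x‖ * ‖x‖ * ‖x‖ := by
      rw [← Real.rpow_add_one hx'.ne', ← Real.rpow_add_one hx'.ne', ← Real.rpow_add_one hx'.ne']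
      norm_num
    have h3 : ‖(2 : ℕ) • innerSL ℝ x‖ ≤ 2 * ‖x‖ := by
      rw [two_smul]
      exact (norm_add_le _ _).trans (by rw [innerSL_apply_norm]; linarith)
    rw [add_mul]
    refine (norm_add_le _ _).trans (add_le_add ?_ ?_)
    · rw [e2, norm_smul, norm_smul, norm_mul, norm_mul]
      calc _ ≤ (‖x‖ * ‖x‖) * ((1 / 4) * (C' * ‖x‖ ^ (2 * (7 / 4 - (3:ℕ)) : ℝ)) * (2 * ‖x‖)) := by
            gcongr
            · exact coord_le _ x
            · exact coord_le _ x
            · norm_num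
            · exact h2
        _ = _ := by ring
    · rw [e1, norm_smul]
      have h4 : ‖x γ • (EuclideanSpace.proj ρ : E3 →L[ℝ] ℝ) +
          x ρ • (EuclideanSpace.proj γ : E3 →L[ℝ] ℝ)‖ ≤ ‖x‖ * 1 + ‖x‖ * 1 := by
        refine (norm_add_le _ _).trans ?_
        rw [norm_smul, norm_smul]
        gcongr
        · exact coord_le _ x
        · exact proj_norm _
        · exact coord_le _ x
        · exact proj_norm _
      calc _ ≤ (C * ‖x‖ ^ (2 * (7 / 4 - (2:ℕ)) : ℝ)) * (‖x‖ * 1 + ‖x‖ * 1) := by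
            gcongr
            exact h1
        _ = _ := by ring

end FTS


namespace FTS

open Set Filter Topology

local notation "E3" => EuclideanSpace ℝ (Fin 3)

lemma gauss_int (t : ℝ) (ht : 0 < t) :
    Integrable (fun ξ : E3 => (1 + ‖ξ‖ ^ 2) * Real.exp (-(t * ‖ξ‖ ^ 2))) := by
  have h1 : Integrable (fun ξ : E3 => Real.exp (-(t / 2 * ‖ξ‖ ^ 2))) := by
    have := (GaussianFourier.integrable_cexp_neg_mul_sq_norm_add (V := E3) (b := ((t / 2 : ℝ) : ℂ))
      (by simpa using ht) 0 0).norm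
    refine this.congr (Eventually.of_forall fun ξ => ?_)
    simp only [Complex.norm_exp]
    congr 1
    simp [← Complex.ofReal_pow]
  refine Integrable.mono' (h1.const_mul (1 + 2 / t))
    (Continuous.aestronglyMeasurable (by fun_prop)) (Eventually.of_forall fun ξ => ?_)
  rw [Real.norm_of_nonneg (by positivity)]
  have e : Real.exp (-(t * ‖ξ‖ ^ 2)) =
      Real.exp (-(t / 2 * ‖ξ‖ ^ 2)) * Real.exp (-(t / 2 * ‖ξ‖ ^ 2)) := by
    rw [← Real.exp_add]; ring_nf
  rw [e, ← mul_assoc]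
  refine mul_le_mul_of_nonneg_right ?_ (Real.exp_pos _).le
  rw [Real.exp_neg, ← div_eq_mul_inv, div_le_iff₀ (Real.exp_pos _)]
  have h2 := Real.add_one_le_exp (t / 2 * ‖ξ‖ ^ 2)
  have h3 : (1 + 2 / t) * (t / 2 * ‖ξ‖ ^ 2 + 1) = 1 + ‖ξ‖ ^ 2 + (t / 2 * ‖ξ‖ ^ 2 + 2 / t) := by
    field_simp; ring
  have h4 : (0:ℝ) ≤ t / 2 * ‖ξ‖ ^ 2 + 2 / t := by positivity
  have h5 := mul_le_mul_of_nonneg_left h2 (by positivity : 0 ≤ 1 + 2 / t)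
  linarith

/-- Gaussian times plane wave. -/
def ge (t : ℝ) (y ξ : E3) : ℂ := Complex.exp (-(t : ℂ) * ‖ξ‖ ^ 2 + (-Complex.I) * (⟪y, ξ⟫ : ℝ))

lemma ge_norm (t : ℝ) (y ξ : E3) : ‖ge t y ξ‖ = Real.exp (-(t * ‖ξ‖ ^ 2)) := by
  rw [ge, Complex.norm_exp]
  congr 1
  simp [← Complex.ofReal_pow]

lemma ge_cont (t : ℝ) (y : E3) : Continuous (ge t y) := by
  unfold ge; fun_prop

lemma ge_dom (t : ℝ) (ht : 0 < t) (y : E3) (p : E3 → ℂ) (hp : Continuous p) (C : ℝ)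
    (hb : ∀ ξ, ‖p ξ‖ ≤ C * (1 + ‖ξ‖ ^ 2)) : Integrable (fun ξ => p ξ * ge t y ξ) := by
  refine Integrable.mono' ((gauss_int t ht).const_mul C)
    (hp.mul (ge_cont t y)).aestronglyMeasurable (Eventually.of_forall fun ξ => ?_)
  rw [norm_mul, ge_norm, ← mul_assoc]
  exact mul_le_mul_of_nonneg_right (hb ξ) (Real.exp_pos _).le

lemma ge_deriv (t : ℝ) (y ξ : E3) : HasFDerivAt (ge t y)
    (ge t y ξ • (-(t : ℂ) • (Complex.ofRealCLM ∘L (2 • innerSL ℝ ξ)) +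
      (-Complex.I) • (Complex.ofRealCLM ∘L innerSL ℝ y))) ξ := by
  unfold ge
  refine HasFDerivAt.cexp (HasFDerivAt.add (HasFDerivAt.const_mul ?_ _)
    (HasFDerivAt.const_mul ?_ _))
  · have := Complex.ofRealCLM.hasFDerivAt.comp ξ (hasStrictFDerivAt_norm_sq ξ).hasFDerivAt
    convert! this using 1
    ext x; simp
  · exact Complex.ofRealCLM.hasFDerivAt.comp ξ (innerSL ℝ y).hasFDerivAt

lemma ge_fderiv (t : ℝ) (y ξ : E3) (γ : Fin 3) :
    fderiv ℝ (ge t y) ξ (EuclideanSpace.single γ 1) =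
      (-(2 * t : ℂ) * ξ γ - Complex.I * y γ) * ge t y ξ := by
  rw [(ge_deriv t y ξ).fderiv]
  simp [EuclideanSpace.inner_single_right]
  ring

lemma c1 (γ : Fin 3) (ξ : E3) : ‖(ξ γ : ℂ)‖ ≤ 1 + ‖ξ‖ ^ 2 := by
  rw [Complex.norm_real, Real.norm_eq_abs]
  have := coord_le γ ξ
  nlinarith [sq_nonneg (‖ξ‖ - 1)]

lemma c2 (γ ρ : Fin 3) (ξ : E3) : ‖(ξ γ : ℂ) * ξ ρ‖ ≤ 1 + ‖ξ‖ ^ 2 := by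
  rw [norm_mul, Complex.norm_real, Real.norm_eq_abs, Complex.norm_real, Real.norm_eq_abs]
  have := mul_le_mul (coord_le γ ξ) (coord_le ρ ξ) (abs_nonneg _) (norm_nonneg _)
  nlinarith

lemma int0 (t : ℝ) (ht : 0 < t) (y : E3) : Integrable (ge t y) := by
  simpa using ge_dom t ht y (fun _ => 1) (by fun_prop) 1 (fun ξ => by simp)

lemma int1 (t : ℝ) (ht : 0 < t) (y : E3) (γ : Fin 3) :
    Integrable (fun ξ : E3 => (ξ γ : ℂ) * ge t y ξ) :=
  ge_dom t ht y (fun ξ => (ξ γ : ℂ)) (by fun_prop) 1 (fun ξ => by rw [one_mul]; exact c1 γ ξ)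

lemma int2 (t : ℝ) (ht : 0 < t) (y : E3) (γ ρ : Fin 3) :
    Integrable (fun ξ : E3 => (ξ γ : ℂ) * ξ ρ * ge t y ξ) :=
  ge_dom t ht y (fun ξ => (ξ γ : ℂ) * ξ ρ) (by fun_prop) 1
    (fun ξ => by rw [one_mul]; exact c2 γ ρ ξ)

lemma mom1 (t : ℝ) (ht : 0 < t) (y : E3) (γ : Fin 3) :
    ∫ ξ : E3, (ξ γ : ℂ) * ge t y ξ = -Complex.I * y γ / (2 * t) * ∫ ξ : E3, ge t y ξ := by
  have htc : (t : ℂ) ≠ 0 := by exact_mod_cast ht.ne'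
  have h := integral_mul_fderiv_eq_neg_fderiv_mul_of_integrable (μ := (volume : Measure E3))
    (f := fun _ => (1 : ℂ)) (g := ge t y) (v := EuclideanSpace.single γ 1)
    (by simp) ?_ (by simpa using int0 t ht y) (fun x _ => by fun_prop)
    (fun x _ => (ge_deriv t y x).differentiableAt)
  · simp only [ge_fderiv, one_mul, sub_mul] at h
    rw [integral_sub] at h
    · simp only [mul_assoc, integral_const_mul] at h
      simp at h
      field_simp
      linear_combination (-1) * h
    · simpa only [mul_assoc] using (int1 t ht y γ).const_mul (-(2 * t : ℂ))
    · simpa only [mul_assoc] using (int0 t ht y).const_mul (Complex.I * y γ)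
  · simp only [ge_fderiv, one_mul, sub_mul]
    refine Integrable.sub ?_ ?_
    · simpa only [mul_assoc] using (int1 t ht y γ).const_mul (-(2 * t : ℂ))
    · simpa only [mul_assoc] using (int0 t ht y).const_mul (Complex.I * y γ)

lemma proj_fderiv (ρ γ : Fin 3) (x : E3) :
    fderiv ℝ (fun ξ : E3 => (ξ ρ : ℂ)) x (EuclideanSpace.single γ 1) = if γ = ρ then 1 else 0 := by
  have : HasFDerivAt (fun ξ : E3 => (ξ ρ : ℂ))
      (Complex.ofRealCLM ∘L (EuclideanSpace.proj ρ : E3 →L[ℝ] ℝ)) x :=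
    Complex.ofRealCLM.hasFDerivAt.comp x (EuclideanSpace.proj ρ : E3 →L[ℝ] ℝ).hasFDerivAt
  rw [this.fderiv]
  by_cases h : γ = ρ
  · subst h; simp
  · simp [h, Ne.symm h]

lemma mom2 (t : ℝ) (ht : 0 < t) (y : E3) (γ ρ : Fin 3) :
    ∫ ξ : E3, (ξ γ : ℂ) * ξ ρ * ge t y ξ =
      ((if γ = ρ then 1 else 0) / (2 * t) - y γ * y ρ / (4 * t ^ 2)) * ∫ ξ : E3, ge t y ξ := by
  have htc : (t : ℂ) ≠ 0 := by exact_mod_cast ht.ne'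
  have i1 : Integrable (fun ξ : E3 => -(2 * t : ℂ) * (ξ γ * ξ ρ * ge t y ξ)) :=
    (int2 t ht y γ ρ).const_mul (-(2 * t : ℂ))
  have i2 : Integrable (fun ξ : E3 => Complex.I * y γ * (ξ ρ * ge t y ξ)) :=
    (int1 t ht y ρ).const_mul (Complex.I * y γ)
  have e : ∀ ξ : E3, (ξ ρ : ℂ) * ((-(2 * t : ℂ) * ξ γ - Complex.I * y γ) * ge t y ξ) =
      -(2 * t : ℂ) * (ξ γ * ξ ρ * ge t y ξ) - Complex.I * y γ * (ξ ρ * ge t y ξ) := by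
    intro ξ; ring
  have h := integral_mul_fderiv_eq_neg_fderiv_mul_of_integrable (μ := (volume : Measure E3))
    (f := fun ξ => (ξ ρ : ℂ)) (g := ge t y) (v := EuclideanSpace.single γ 1)
    ?_ ?_ (int1 t ht y ρ) (fun x _ => by fun_prop)
    (fun x _ => (ge_deriv t y x).differentiableAt)
  · simp only [ge_fderiv, proj_fderiv, e] at h
    rw [integral_sub i1 i2, integral_const_mul, integral_const_mul, integral_const_mul,
      mom1 t ht] at h
    field_simp at h ⊢
    have hI := Complex.I_sq
    linear_combination (-2) * h + (2 * y γ * y ρ * ∫ ξ : E3, ge t y ξ) * hI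
  · simp only [proj_fderiv]
    exact (int0 t ht y).const_mul _
  · simp only [ge_fderiv, e]
    exact i1.sub i2

lemma mom0 (t : ℝ) (ht : 0 < t) (y : E3) :
    ∫ ξ : E3, ge t y ξ = ((Real.pi / t) ^ (3 / 2 : ℝ) * Real.exp (-(‖y‖ ^ 2 / (4 * t))) : ℝ) := by
  unfold ge
  rw [GaussianFourier.integral_cexp_neg_mul_sq_norm_add (by simpa using ht)]
  push_cast
  rw [Complex.ofReal_cpow (by have := Real.pi_pos; positivity)]
  simp
  ring_nf
  simp

end FTS


namespace FTS

open Set Filter Topology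

local notation "E3" => EuclideanSpace ℝ (Fin 3)

lemma prod_dom (F : E3 → ℝ → ℂ) (hF : Measurable (Function.uncurry F))
    (f : E3 → ℝ) (g : ℝ → ℝ) (hf : Integrable f) (hg : IntegrableOn g (Ioi 0))
    (hb : ∀ y t, y ≠ 0 → 0 < t → ‖F y t‖ ≤ f y * g t) :
    Integrable (Function.uncurry F)
      ((volume : Measure E3).prod ((volume : Measure ℝ).restrict (Ioi 0))) := by
  have h := Integrable.mul_prod hf hg
  refine Integrable.mono' h hF.aestronglyMeasurable ?_
  rw [← restrict_compl_singleton (μ := (volume : Measure E3)) 0, Measure.prod_restrict]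
  refine (ae_restrict_iff' ((measurableSet_singleton _).compl.prod measurableSet_Ioi)).2
    (Eventually.of_forall fun z hz => ?_)
  exact hb z.1 z.2 hz.1 hz.2

/-- Fourier transform with the convention of the statement. -/
def ft (φ : E3 → ℂ) (ξ : E3) : ℂ :=
  ∫ y : E3, Complex.exp (-Complex.I * (⟪y, ξ⟫ : ℝ)) * φ y

lemma phase_norm (y ξ : E3) : ‖Complex.exp (-Complex.I * (⟪y, ξ⟫ : ℝ))‖ = 1 := by
  rw [Complex.norm_exp]; simp

lemma ft_eq (φ : E3 → ℂ) (hφ : ContDiff ℝ (⊤ : ℕ∞) φ) (hc : HasCompactSupport φ) (ξ : E3) :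
    ft φ ξ = (FourierTransform.fourier (hc.toSchwartzMap hφ) : SchwartzMap E3 ℂ)
      ((2 * Real.pi)⁻¹ • ξ) := by
  rw [SchwartzMap.fourier_coe, Real.fourier_eq', ft]
  congr 1; ext y
  have hpi : (Real.pi : ℂ) ≠ 0 := by exact_mod_cast Real.pi_ne_zero
  rw [inner_smul_right, smul_eq_mul]
  congr 2
  push_cast
  field_simp

lemma ft_int (φ : E3 → ℂ) (hφ : ContDiff ℝ (⊤ : ℕ∞) φ) (hc : HasCompactSupport φ) :
    Integrable (ft φ) := by
  have h : ft φ = fun ξ => (FourierTransform.fourier (hc.toSchwartzMap hφ) : SchwartzMap E3 ℂ)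
      ((2 * Real.pi)⁻¹ • ξ) := funext (ft_eq φ hφ hc)
  rw [h]
  exact (SchwartzMap.integrable _).comp_smul (by have := Real.pi_pos; positivity)

lemma ft_cont (φ : E3 → ℂ) (hφ : ContDiff ℝ (⊤ : ℕ∞) φ) (hc : HasCompactSupport φ) :
    Continuous (ft φ) := by
  have h : ft φ = fun ξ => (FourierTransform.fourier (hc.toSchwartzMap hφ) : SchwartzMap E3 ℂ)
      ((2 * Real.pi)⁻¹ • ξ) := funext (ft_eq φ hφ hc)
  rw [h]
  exact (SchwartzMap.continuous _).comp (by fun_prop)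

lemma phase_int (φ : E3 → ℂ) (hφ : Continuous φ) (hc : HasCompactSupport φ) (ξ : E3) :
    Integrable (fun y : E3 => Complex.exp (-Complex.I * (⟪y, ξ⟫ : ℝ)) * φ y) := by
  refine Continuous.integrable_of_hasCompactSupport (by fun_prop) ?_
  exact hc.mul_left

lemma inv_int (φ : E3 → ℂ) (hφ : Continuous φ) (hc : HasCompactSupport φ) :
    Integrable (fun y : E3 => ‖y‖⁻¹ * ‖φ y‖) := by
  have hc' : HasCompactSupport (fun y : E3 => (Real.exp ‖y‖ : ℂ) * φ y) := hc.mul_left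
  obtain ⟨B, hB⟩ := hc'.exists_bound_of_continuous (by fun_prop)
  have h1 : Integrable (fun y : E3 => ‖y‖⁻¹ * Real.exp (-‖y‖)) := by
    refine (integrable_fun_norm_addHaar (volume : Measure E3)
      (f := fun r => r⁻¹ * Real.exp (-r))).2 ?_
    refine (Real.GammaIntegral_convergent (s := 2) (by norm_num)).congr_fun (fun r hr => ?_)
      measurableSet_Ioi
    have hr : 0 < r := hr
    norm_num
    field_simp
  refine Integrable.mono' (h1.const_mul B) ?_ (Eventually.of_forall fun y => ?_)
  · have := hφ.measurable
    exact Measurable.aestronglyMeasurable (by fun_prop)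
  · rw [Real.norm_of_nonneg (by positivity)]
    have := hB y
    rw [norm_mul, Complex.norm_real, Real.norm_of_nonneg (Real.exp_pos _).le] at this
    have h2 : ‖φ y‖ ≤ B * Real.exp (-‖y‖) := by
      rw [Real.exp_neg, ← div_eq_mul_inv, le_div_iff₀ (Real.exp_pos _)]; linarith
    calc _ ≤ ‖y‖⁻¹ * (B * Real.exp (-‖y‖)) := by gcongr
      _ = _ := by ring

/-- the real kernel at time `t` -/
def kt (γ ρ : Fin 3) (y : E3) (t : ℝ) : ℝ :=
  ((if γ = ρ then 1 else 0) / (2 * t) - y γ * y ρ / (4 * t ^ 2)) *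
    Real.exp (-(‖y‖ ^ 2 / (4 * t)))

lemma step_t (γ ρ : Fin 3) (φ : E3 → ℂ) (hφ : Continuous φ) (hc : HasCompactSupport φ)
    (t : ℝ) (ht : 0 < t) :
    ∫ ξ : E3, ((ξ γ * ξ ρ * Real.exp (-(t * ‖ξ‖ ^ 2)) : ℝ) : ℂ) * ft φ ξ =
      ((Real.pi / t) ^ (3 / 2 : ℝ) : ℝ) * ∫ y : E3, (kt γ ρ y t : ℂ) * φ y := by
  have hint : Integrable (Function.uncurry fun (ξ y : E3) => (ξ γ : ℂ) * ξ ρ * ge t y ξ * φ y)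
      ((volume : Measure E3).prod volume) := by
    have h := Integrable.mul_prod (gauss_int t ht)
      (hφ.integrable_of_hasCompactSupport hc (μ := volume)).norm
    refine Integrable.mono' h ?_ (Eventually.of_forall fun z => ?_)
    · refine Continuous.aestronglyMeasurable ?_
      unfold ge Function.uncurry
      fun_prop
    · simp only [Function.uncurry]
      rw [norm_mul, norm_mul, ge_norm]
      gcongr
      exact c2 γ ρ z.1
  have e1 : ∀ ξ : E3, ((ξ γ * ξ ρ * Real.exp (-(t * ‖ξ‖ ^ 2)) : ℝ) : ℂ) * ft φ ξ =
      ∫ y : E3, (ξ γ : ℂ) * ξ ρ * ge t y ξ * φ y := by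
    intro ξ
    rw [ft, ← integral_const_mul]
    congr 1; ext y
    rw [ge, Complex.exp_add]
    push_cast
    ring_nf
  simp_rw [e1]
  rw [integral_integral_swap hint, ← integral_const_mul]
  congr 1; ext y
  rw [integral_mul_const, mom2 t ht, mom0 t ht, kt]
  push_cast
  split_ifs <;> · push_cast; ring

lemma symbol_eq (x : ℝ) (hx : 0 < x) : Real.Gamma (5 / 2) * (1 / x ^ (5 / 2 : ℝ)) =
    ∫ t in Ioi (0:ℝ), t ^ (3 / 2 : ℝ) * Real.exp (-(x * t)) := by
  have := Real.integral_rpow_mul_exp_neg_mul_Ioi (a := 5 / 2) (by norm_num) hx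
  norm_num at this ⊢
  rw [this, Real.inv_rpow hx.le]
  ring

lemma xexp_le (x : ℝ) : x * Real.exp (-x) ≤ 1 := by
  rw [Real.exp_neg, ← div_eq_mul_inv, div_le_one (Real.exp_pos _)]
  linarith [Real.add_one_le_exp x]

lemma step_xi (γ ρ : Fin 3) (φ : E3 → ℂ) (hφ : ContDiff ℝ (⊤ : ℕ∞) φ) (hc : HasCompactSupport φ) :
    (Real.Gamma (5 / 2) : ℂ) * ∫ ξ : E3,
        ((ξ γ * ξ ρ / (1 + ‖ξ‖ ^ 2) ^ ((5 : ℝ) / 2) : ℝ) : ℂ) * ft φ ξ =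
      ∫ t in Ioi (0:ℝ), ((t ^ (3 / 2 : ℝ) * Real.exp (-t) : ℝ) : ℂ) *
        ∫ ξ : E3, ((ξ γ * ξ ρ * Real.exp (-(t * ‖ξ‖ ^ 2)) : ℝ) : ℂ) * ft φ ξ := by
  have hint := prod_dom (fun (ξ : E3) (t : ℝ) => ((t ^ (3 / 2 : ℝ) * Real.exp (-t) : ℝ) : ℂ) *
      (((ξ γ * ξ ρ * Real.exp (-(t * ‖ξ‖ ^ 2)) : ℝ) : ℂ) * ft φ ξ)) ?_ (fun ξ => ‖ft φ ξ‖)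
      (fun t => Real.exp (-t) * t ^ ((3 / 2 : ℝ) - 1)) (ft_int φ hφ hc).norm
      (Real.GammaIntegral_convergent (by norm_num)) ?_
  · rw [← integral_const_mul]
    simp_rw [← integral_const_mul]
    rw [← integral_integral_swap hint]
    congr 1; ext ξ
    have e := symbol_eq (1 + ‖ξ‖ ^ 2) (by positivity)
    have e2 : (Real.Gamma (5 / 2) : ℂ) *
        (((ξ γ * ξ ρ / (1 + ‖ξ‖ ^ 2) ^ ((5 : ℝ) / 2) : ℝ) : ℂ) * ft φ ξ) =
        ((Real.Gamma (5 / 2) * (1 / (1 + ‖ξ‖ ^ 2) ^ ((5 : ℝ) / 2)) : ℝ) : ℂ) *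
          (ξ γ * ξ ρ * ft φ ξ) := by
      push_cast; ring
    rw [e2, e, ← integral_complex_ofReal, ← integral_mul_const]
    congr 1; ext t
    have : Real.exp (-((1 + ‖ξ‖ ^ 2) * t)) = Real.exp (-t) * Real.exp (-(t * ‖ξ‖ ^ 2)) := by
      rw [← Real.exp_add]; ring_nf
    rw [this]
    push_cast; ring
  · have := (ft_cont φ hφ hc).measurable
    unfold Function.uncurry
    fun_prop
  · intro ξ t _ ht
    rw [norm_mul, norm_mul, Complex.norm_real, Complex.norm_real,
      Real.norm_of_nonneg (by positivity), Real.norm_eq_abs, abs_mul,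
      abs_of_pos (Real.exp_pos (-(t * ‖ξ‖ ^ 2))), abs_mul]
    have h1 : |ξ γ| * |ξ ρ| ≤ ‖ξ‖ ^ 2 := by
      rw [sq]; exact mul_le_mul (coord_le γ ξ) (coord_le ρ ξ) (abs_nonneg _) (norm_nonneg _)
    have h2 := xexp_le (t * ‖ξ‖ ^ 2)
    have h3 : |ξ γ| * |ξ ρ| * Real.exp (-(t * ‖ξ‖ ^ 2)) ≤ t⁻¹ := by
      rw [← one_div, le_div_iff₀ ht]
      calc _ ≤ ‖ξ‖ ^ 2 * Real.exp (-(t * ‖ξ‖ ^ 2)) * t := by gcongr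
        _ = t * ‖ξ‖ ^ 2 * Real.exp (-(t * ‖ξ‖ ^ 2)) := by ring
        _ ≤ 1 := h2
    calc _ ≤ t ^ (3 / 2 : ℝ) * Real.exp (-t) * (t⁻¹ * ‖ft φ ξ‖) := by gcongr
      _ = _ := by
        rw [Real.rpow_sub_one ht.ne']; field_simp

lemma kt_bound (γ ρ : Fin 3) : ∃ C : ℝ, 0 < C ∧ ∀ (y : E3) (t : ℝ), y ≠ 0 → 0 < t →
    |kt γ ρ y t| ≤ C * ‖y‖⁻¹ * t ^ ((1 / 2 : ℝ) - 1) := by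
  obtain ⟨C1, hC1, h1⟩ := exp_bound (1 / 2) (by norm_num)
  obtain ⟨C2, hC2, h2⟩ := exp_bound (3 / 2) (by norm_num)
  refine ⟨C1 + C2, by positivity, fun y t hy ht => ?_⟩
  have hy' : 0 < ‖y‖ := norm_pos_iff.2 hy
  have a1 := h1 _ t (nsq_pos hy) ht
  have a2 := h2 _ t (nsq_pos hy) ht
  rw [sq_rpow] at a1 a2
  have e1 : ‖y‖ ^ (2 * -(1 / 2) : ℝ) = ‖y‖⁻¹ := by
    rw [← Real.rpow_neg_one]; norm_num
  have e2 : ‖y‖ ^ (2 * -(3 / 2) : ℝ) = (‖y‖ ^ 3)⁻¹ := by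
    rw [← Real.rpow_natCast, ← Real.rpow_neg hy'.le]; norm_num
  have e3 : t ^ (3 / 2 : ℝ) = t * t ^ (1 / 2 : ℝ) := by
    rw [← Real.rpow_one_add' ht.le (by norm_num)]; norm_num
  rw [e1] at a1
  rw [e2, e3] at a2
  set X := Real.exp (-(‖y‖ ^ 2 / (4 * t))) with hX
  have hX0 : 0 < X := Real.exp_pos _
  have b1 : |(if γ = ρ then (1:ℝ) else 0) / (2 * t)| ≤ 1 / t := by
    rw [abs_div, abs_of_pos (by positivity : 0 < 2 * t)]
    split_ifs
    · rw [abs_one]; gcongr; linarith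
    · simp; positivity
  have b2 : |y γ * y ρ / (4 * t ^ 2)| ≤ ‖y‖ ^ 2 / t ^ 2 := by
    rw [abs_div, abs_of_pos (by positivity : 0 < 4 * t ^ 2), abs_mul]
    have : |y γ| * |y ρ| ≤ ‖y‖ ^ 2 := by
      rw [sq]; exact mul_le_mul (coord_le γ y) (coord_le ρ y) (abs_nonneg _) (norm_nonneg _)
    gcongr
    nlinarith [sq_nonneg t]
  rw [kt, abs_mul, abs_of_pos hX0]
  calc _ ≤ (1 / t + ‖y‖ ^ 2 / t ^ 2) * X := by
        refine mul_le_mul_of_nonneg_right ?_ hX0.le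
        exact (abs_sub _ _).trans (add_le_add b1 b2)
    _ = 1 / t * X + ‖y‖ ^ 2 / t ^ 2 * X := by ring
    _ ≤ 1 / t * (C1 * (‖y‖⁻¹ * t ^ (1 / 2 : ℝ))) +
        ‖y‖ ^ 2 / t ^ 2 * (C2 * ((‖y‖ ^ 3)⁻¹ * (t * t ^ (1 / 2 : ℝ)))) := by gcongr
    _ = _ := by
        rw [Real.rpow_sub_one ht.ne']; field_simp

lemma kt_int (γ ρ : Fin 3) (y : E3) (hy : y ≠ 0) :
    ∫ t in Ioi (0:ℝ), Real.exp (-t) * kt γ ρ y t =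
      (if γ = ρ then 1 else 0) / 2 * A 1 (‖y‖ ^ 2) - y γ * y ρ / 4 * A 2 (‖y‖ ^ 2) := by
  rw [A, A, ← integral_const_mul, ← integral_const_mul, ← integral_sub]
  · congr 1; ext t
    rw [kt]; ring
  · exact (A_int 1 _ (nsq_pos hy)).const_mul _
  · exact (A_int 2 _ (nsq_pos hy)).const_mul _

lemma gamma_val : Real.Gamma (5 / 2) = 3 / 4 * Real.sqrt Real.pi := by
  rw [show (5 / 2 : ℝ) = (1 / 2 + 1) + 1 by norm_num, Real.Gamma_add_one (by norm_num),
    Real.Gamma_add_one (by norm_num), Real.Gamma_one_half_eq]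
  ring

/-- the regular part -/
def hreg (γ ρ : Fin 3) (y : E3) : ℝ :=
  1 / (12 * Real.pi ^ 2) * ((if γ = ρ then 1 else 0) * (1 + A 1 1 - P 1 + P (‖y‖ ^ 2)) +
    1 / 2 * ((y γ * y ρ) * M 2 (‖y‖ ^ 2)))

lemma hreg_c1 (γ ρ : Fin 3) : ContDiff ℝ 1 (hreg γ ρ) := by
  have h1 := f1_c1
  have h2 := f2_c1 γ ρ
  unfold hreg
  exact contDiff_const.mul ((contDiff_const.mul (contDiff_const.add h1)).add
    (contDiff_const.mul h2))

lemma kernel_eq (γ ρ : Fin 3) (y : E3) (hy : y ≠ 0) :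
    -(1 / (12 * Real.pi ^ 2)) * (2 * y γ * y ρ / ‖y‖ ^ 2
      + (1 + 2 * Real.log ‖y‖) * (if γ = ρ then 1 else 0)) + hreg γ ρ y =
    1 / (6 * Real.pi ^ 2) * ∫ t in Ioi (0:ℝ), Real.exp (-t) * kt γ ρ y t := by
  have hy' : 0 < ‖y‖ := norm_pos_iff.2 hy
  rw [kt_int γ ρ y hy, A_one _ (nsq_pos hy), A_two _ (nsq_pos hy), Real.log_pow, hreg]
  have := Real.pi_pos
  push_cast
  field_simp
  ring

lemma const_eq : (1 / (2 * Real.pi) ^ 3 : ℝ) * Real.pi ^ (3 / 2 : ℝ) =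
    1 / (6 * Real.pi ^ 2) * Real.Gamma (5 / 2) := by
  have := Real.pi_pos
  have hs : 0 < Real.sqrt Real.pi := Real.sqrt_pos.2 this
  have : Real.pi ^ (3 / 2 : ℝ) = Real.pi * Real.sqrt Real.pi := by
    rw [Real.sqrt_eq_rpow, ← Real.rpow_one_add' this.le (by norm_num)]; norm_num
  rw [this, gamma_val]
  field_simp
  norm_num

lemma kt_prod (γ ρ : Fin 3) (φ : E3 → ℂ) (hφ : Continuous φ) (hc : HasCompactSupport φ) :
    Integrable (Function.uncurry fun (y : E3) (t : ℝ) =>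
      ((Real.exp (-t) * kt γ ρ y t : ℝ) : ℂ) * φ y)
      ((volume : Measure E3).prod ((volume : Measure ℝ).restrict (Ioi 0))) := by
  obtain ⟨C, hC, hb⟩ := kt_bound γ ρ
  refine prod_dom _ ?_ (fun y => C * (‖y‖⁻¹ * ‖φ y‖))
    (fun t => Real.exp (-t) * t ^ ((1 / 2 : ℝ) - 1)) ((inv_int φ hφ hc).const_mul C)
    (Real.GammaIntegral_convergent (by norm_num)) ?_
  · have := hφ.measurable
    unfold Function.uncurry kt
    fun_prop
  · intro y t hy ht
    rw [norm_mul, Complex.norm_real, norm_mul, Real.norm_of_nonneg (Real.exp_pos _).le,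
      Real.norm_eq_abs]
    calc _ ≤ Real.exp (-t) * (C * ‖y‖⁻¹ * t ^ ((1 / 2 : ℝ) - 1)) * ‖φ y‖ := by
          gcongr
          exact hb y t hy ht
      _ = _ := by ring

lemma kernel_ae (γ ρ : Fin 3) (φ : E3 → ℂ) :
    (fun y : E3 => ((-(1 / (12 * Real.pi ^ 2)) * (2 * y γ * y ρ / ‖y‖ ^ 2
      + (1 + 2 * Real.log ‖y‖) * (if γ = ρ then 1 else 0)) + hreg γ ρ y : ℝ) : ℂ) * φ y) =ᵐ[volume]
    fun y => ((1 / (6 * Real.pi ^ 2) : ℝ) : ℂ) *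
      ∫ t in Ioi (0:ℝ), ((Real.exp (-t) * kt γ ρ y t : ℝ) : ℂ) * φ y := by
  filter_upwards [compl_mem_ae_iff.2 (measure_singleton (0 : E3))] with y hy
  rw [kernel_eq γ ρ y hy, integral_mul_const, integral_complex_ofReal]
  push_cast
  ring

lemma step_y (γ ρ : Fin 3) (φ : E3 → ℂ) (hφ : ContDiff ℝ (⊤ : ℕ∞) φ) (hc : HasCompactSupport φ) :
    (Real.Gamma (5 / 2) : ℂ) * ∫ ξ : E3,
        ((ξ γ * ξ ρ / (1 + ‖ξ‖ ^ 2) ^ ((5 : ℝ) / 2) : ℝ) : ℂ) * ft φ ξ =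
      ((Real.pi ^ (3 / 2 : ℝ) : ℝ) : ℂ) *
        ∫ y : E3, ∫ t in Ioi (0:ℝ), ((Real.exp (-t) * kt γ ρ y t : ℝ) : ℂ) * φ y := by
  rw [step_xi γ ρ φ hφ hc, integral_integral_swap (kt_prod γ ρ φ hφ.continuous hc),
    ← integral_const_mul]
  refine setIntegral_congr_fun measurableSet_Ioi fun t ht => ?_
  have ht : 0 < t := ht
  simp only
  rw [step_t γ ρ φ hφ.continuous hc t ht, ← mul_assoc, ← Complex.ofReal_mul]
  have e : t ^ (3 / 2 : ℝ) * Real.exp (-t) * (Real.pi / t) ^ (3 / 2 : ℝ) =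
      Real.pi ^ (3 / 2 : ℝ) * Real.exp (-t) := by
    rw [Real.div_rpow Real.pi_pos.le ht.le]
    field_simp
  rw [e, Complex.ofReal_mul, mul_assoc, ← integral_const_mul (Real.exp (-t) : ℂ)]
  congr 2; ext y
  push_cast; ring

lemma symbol_int (γ ρ : Fin 3) (φ : E3 → ℂ) (hφ : ContDiff ℝ (⊤ : ℕ∞) φ)
    (hc : HasCompactSupport φ) : Integrable (fun ξ : E3 =>
      ((ξ γ * ξ ρ / (1 + ‖ξ‖ ^ 2) ^ ((5 : ℝ) / 2) : ℝ) : ℂ) * ft φ ξ) := by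
  refine Integrable.mono' (ft_int φ hφ hc).norm ?_ (Eventually.of_forall fun ξ => ?_)
  · have := (ft_cont φ hφ hc).measurable
    exact Measurable.aestronglyMeasurable (by fun_prop)
  · rw [norm_mul, Complex.norm_real, norm_div, norm_mul]
    refine mul_le_of_le_one_left (norm_nonneg _) ?_
    have h0 : (1:ℝ) ≤ 1 + ‖ξ‖ ^ 2 := by nlinarith [sq_nonneg ‖ξ‖]
    have h1 : |ξ γ| * |ξ ρ| ≤ ‖ξ‖ ^ 2 := by
      rw [sq]; exact mul_le_mul (coord_le γ ξ) (coord_le ρ ξ) (abs_nonneg _) (norm_nonneg _)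
    have h2 : (1 + ‖ξ‖ ^ 2) ^ (1 : ℝ) ≤ (1 + ‖ξ‖ ^ 2) ^ ((5 : ℝ) / 2) :=
      Real.rpow_le_rpow_of_exponent_le h0 (by norm_num)
    rw [Real.rpow_one] at h2
    rw [Real.norm_of_nonneg (by positivity : 0 ≤ (1 + ‖ξ‖ ^ 2) ^ ((5 : ℝ) / 2)),
      div_le_one (by positivity), Real.norm_eq_abs, Real.norm_eq_abs]
    linarith

end FTS

theorem fourier_transform_of_symbol (γ ρ : Fin 3) :
    ∃ h : EuclideanSpace ℝ (Fin 3) → ℝ, ContDiff ℝ 1 h ∧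
      ∀ φ : EuclideanSpace ℝ (Fin 3) → ℂ, ContDiff ℝ (⊤ : ℕ∞) φ → HasCompactSupport φ →
        (∀ ξ : EuclideanSpace ℝ (Fin 3),
          Integrable (fun y : EuclideanSpace ℝ (Fin 3) =>
            Complex.exp (-Complex.I * (⟪y, ξ⟫ : ℝ)) * φ y)) ∧
        Integrable (fun ξ : EuclideanSpace ℝ (Fin 3) =>
          ((ξ γ * ξ ρ / (1 + ‖ξ‖ ^ 2) ^ ((5 : ℝ) / 2) : ℝ) : ℂ) *
            ∫ y : EuclideanSpace ℝ (Fin 3), Complex.exp (-Complex.I * (⟪y, ξ⟫ : ℝ)) * φ y) ∧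
        Integrable (fun y : EuclideanSpace ℝ (Fin 3) =>
          ((-(1 / (12 * Real.pi ^ 2)) *
              (2 * y γ * y ρ / ‖y‖ ^ 2
                + (1 + 2 * Real.log ‖y‖) * (if γ = ρ then 1 else 0)) + h y : ℝ) : ℂ) * φ y) ∧
        (1 / (2 * Real.pi) ^ 3 : ℂ) *
            (∫ ξ : EuclideanSpace ℝ (Fin 3),
              ((ξ γ * ξ ρ / (1 + ‖ξ‖ ^ 2) ^ ((5 : ℝ) / 2) : ℝ) : ℂ) *
                ∫ y : EuclideanSpace ℝ (Fin 3),
                  Complex.exp (-Complex.I * (⟪y, ξ⟫ : ℝ)) * φ y)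
          = ∫ y : EuclideanSpace ℝ (Fin 3),
              ((-(1 / (12 * Real.pi ^ 2)) *
                  (2 * y γ * y ρ / ‖y‖ ^ 2
                    + (1 + 2 * Real.log ‖y‖) * (if γ = ρ then 1 else 0)) + h y : ℝ) : ℂ) * φ y := by
  refine ⟨FTS.hreg γ ρ, FTS.hreg_c1 γ ρ, fun φ hφ hc => ⟨FTS.phase_int φ hφ.continuous hc,
    FTS.symbol_int γ ρ φ hφ hc, ?_, ?_⟩⟩
  · refine Integrable.congr ?_ (FTS.kernel_ae γ ρ φ).symm
    exact (FTS.kt_prod γ ρ φ hφ.continuous hc).integral_prod_left.const_mul _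
  · rw [integral_congr_ae (FTS.kernel_ae γ ρ φ), integral_const_mul]
    have h := FTS.step_y γ ρ φ hφ hc
    have hG : (Real.Gamma (5 / 2) : ℂ) ≠ 0 := by
      exact_mod_cast (Real.Gamma_pos_of_pos (by norm_num : (0 : ℝ) < 5 / 2)).ne'
    refine mul_left_cancel₀ hG ?_
    have hk : (1 / (2 * Real.pi) ^ 3 : ℂ) * ((Real.pi ^ (3 / 2 : ℝ) : ℝ) : ℂ) =
        ((1 / (6 * Real.pi ^ 2) : ℝ) : ℂ) * (Real.Gamma (5 / 2) : ℂ) := by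
      rw [← Complex.ofReal_mul, ← FTS.const_eq]
      push_cast
      ring
    rw [mul_left_comm]
    refine (congrArg (fun z => (1 / (2 * Real.pi) ^ 3 : ℂ) * z) h).trans ?_
    rw [← mul_assoc, hk]
    ring
end
end

section
/- Let c = (c_{γρ}) be a real 3×3 matrix with tr(c) = ∑_γ c_{γγ} = 0. Then there exists a continuous function k : ℝ³ → ℝ such that for every smooth compactly supported function φ : ℝ³ → ℂ one has (1/(2π)³) ∫_{ℝ³} ( ∑_{γ,ρ} c_{γρ} ξ_γ ξ_ρ / (1+|ξ|²)^{5/2} ) ( ∫_{ℝ³} e^{−i⟨y,ξ⟩} φ(y) dy ) dξ = ∫_{ℝ³} ( −(1/(6π²)) ∑_{γ,ρ} c_{γρ} y_γ y_ρ/|y|² + k(y) ) φ(y) dy. -/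
open MeasureTheory
open scoped RealInnerProductSpace
noncomputable section

namespace TS
abbrev E3 := EuclideanSpace ℝ (Fin 3)

/-- The Gaussian times a character. -/
def G (t : ℝ) (y ξ : E3) : ℂ := Complex.exp (-(t:ℂ) * ‖ξ‖ ^ 2 + (-Complex.I) * (⟪y, ξ⟫ : ℝ))

lemma norm_G (t : ℝ) (y ξ : E3) : ‖G t y ξ‖ = Real.exp (-t * ‖ξ‖ ^ 2) := by
  rw [G, Complex.norm_exp]
  congr 1
  simp [← Complex.ofReal_pow]

lemma continuous_G (t : ℝ) (y : E3) : Continuous (G t y) := by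
  unfold G; fun_prop

lemma integrable_gauss {t : ℝ} (ht : 0 < t) :
    Integrable (fun ξ : E3 => Real.exp (-t * ‖ξ‖ ^ 2)) := by
  have := (GaussianFourier.integrable_cexp_neg_mul_sq_norm_add (V := E3) (b := (t:ℂ))
    (by simpa using ht) 0 0).norm
  refine this.congr (Filter.Eventually.of_forall fun ξ => ?_)
  simp [Complex.norm_exp, ← Complex.ofReal_pow]

lemma integrable_sq_gauss {t : ℝ} (ht : 0 < t) :
    Integrable (fun ξ : E3 => (1 + ‖ξ‖ ^ 2) * Real.exp (-t * ‖ξ‖ ^ 2)) := by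
  refine ((integrable_gauss (half_pos ht)).const_mul (1 + 2 / t)).mono' ?_
    (Filter.Eventually.of_forall fun ξ => ?_)
  · exact Continuous.aestronglyMeasurable (by fun_prop)
  · rw [Real.norm_of_nonneg (by positivity)]
    have e1 : Real.exp (-t * ‖ξ‖ ^ 2) =
        Real.exp (-(t / 2) * ‖ξ‖ ^ 2) * Real.exp (-(t / 2) * ‖ξ‖ ^ 2) := by
      rw [← Real.exp_add]; ring_nf
    have e2 : 1 + t / 2 * ‖ξ‖ ^ 2 ≤ Real.exp (t / 2 * ‖ξ‖ ^ 2) := by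
      have := Real.add_one_le_exp (t / 2 * ‖ξ‖ ^ 2); linarith
    have e3 : (1 + ‖ξ‖ ^ 2) * Real.exp (-(t / 2) * ‖ξ‖ ^ 2) ≤ 1 + 2 / t := by
      rw [neg_mul, Real.exp_neg, ← div_eq_mul_inv, div_le_iff₀ (Real.exp_pos _)]
      calc 1 + ‖ξ‖ ^ 2 ≤ (1 + 2 / t) * (1 + t / 2 * ‖ξ‖ ^ 2) := by
            have : (1 + 2 / t) * (1 + t / 2 * ‖ξ‖ ^ 2)
              = 1 + ‖ξ‖ ^ 2 + 2 / t + t / 2 * ‖ξ‖ ^ 2 := by field_simp; ring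
            rw [this]
            have : 0 ≤ 2 / t := by positivity
            have : 0 ≤ t / 2 * ‖ξ‖ ^ 2 := by positivity
            linarith
        _ ≤ _ := by gcongr
    rw [e1, ← mul_assoc]
    gcongr

lemma integrable_mul_G {t : ℝ} (ht : 0 < t) (y : E3) (f : E3 → ℂ) (hf : Continuous f) (C : ℝ)
    (hb : ∀ ξ, ‖f ξ‖ ≤ C * (1 + ‖ξ‖ ^ 2)) : Integrable (fun ξ => f ξ * G t y ξ) := by
  refine ((integrable_sq_gauss ht).const_mul C).mono'
    (hf.mul (continuous_G t y)).aestronglyMeasurable (Filter.Eventually.of_forall fun ξ => ?_)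
  rw [norm_mul, norm_G, ← mul_assoc]
  gcongr
  exact hb ξ

lemma hasFDerivAt_G (t : ℝ) (y ξ : E3) :
    ∃ L : E3 →L[ℝ] ℂ, HasFDerivAt (G t y) L ξ ∧
      ∀ v, L v = ((-2 * t * ⟪ξ, v⟫ : ℝ) - Complex.I * (⟪y, v⟫ : ℝ)) * G t y ξ := by
  have h1 : HasFDerivAt (fun ξ : E3 => ‖ξ‖ ^ 2) (2 • (innerSL ℝ ξ)) ξ :=
    (hasStrictFDerivAt_norm_sq ξ).hasFDerivAt
  have h2 : HasFDerivAt (fun ξ : E3 => (⟪y, ξ⟫ : ℝ)) (innerSL ℝ y) ξ :=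
    (innerSL ℝ y).hasFDerivAt
  have hd1 := (Complex.ofRealCLM.hasFDerivAt.comp ξ h1).const_mul (-(t:ℂ))
  have hd2 := (Complex.ofRealCLM.hasFDerivAt.comp ξ h2).const_mul (-Complex.I)
  have h := (hd1.add hd2).cexp
  refine ⟨_, h.congr_of_eventuallyEq (Filter.Eventually.of_forall fun ξ => ?_), ?_⟩
  · simp [G]
  · intro v
    simp [G]
    ring

lemma norm_inner_le (v ξ : E3) : ‖((⟪ξ, v⟫ : ℝ) : ℂ)‖ ≤ ‖v‖ * (1 + ‖ξ‖ ^ 2) := by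
  rw [Complex.norm_real]
  refine (norm_inner_le_norm ξ v).trans ?_
  have : ‖ξ‖ ≤ 1 + ‖ξ‖ ^ 2 := by nlinarith [sq_nonneg (‖ξ‖ - 1), norm_nonneg ξ]
  rw [mul_comm]
  gcongr

lemma norm_inner_mul_le (v w ξ : E3) :
    ‖((⟪ξ, v⟫ : ℝ) : ℂ) * ((⟪ξ, w⟫ : ℝ) : ℂ)‖ ≤ (‖v‖ * ‖w‖) * (1 + ‖ξ‖ ^ 2) := by
  rw [norm_mul, Complex.norm_real, Complex.norm_real]
  calc _ ≤ (‖ξ‖ * ‖v‖) * (‖ξ‖ * ‖w‖) := by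
        gcongr
        exacts [norm_inner_le_norm ξ v, norm_inner_le_norm ξ w]
    _ = (‖v‖ * ‖w‖) * ‖ξ‖ ^ 2 := by ring
    _ ≤ _ := by gcongr; linarith

lemma integrable_G {t : ℝ} (ht : 0 < t) (y : E3) : Integrable (G t y) := by
  have := integrable_mul_G ht y (fun _ => 1) continuous_const 1 (fun ξ => by
    simp)
  simpa using this

lemma integrable_G1 {t : ℝ} (ht : 0 < t) (y v : E3) :
    Integrable (fun ξ => ((⟪ξ, v⟫ : ℝ) : ℂ) * G t y ξ) :=
  integrable_mul_G ht y _ (by fun_prop) _ (norm_inner_le v)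

lemma integrable_G2 {t : ℝ} (ht : 0 < t) (y v w : E3) :
    Integrable (fun ξ => (((⟪ξ, v⟫ : ℝ) : ℂ) * ((⟪ξ, w⟫ : ℝ) : ℂ)) * G t y ξ) :=
  integrable_mul_G ht y _ (by fun_prop) _ (norm_inner_mul_le v w)

lemma fderiv_G (t : ℝ) (y ξ v : E3) : fderiv ℝ (G t y) ξ v =
    ((-2 * t * ⟪ξ, v⟫ : ℝ) - Complex.I * (⟪y, v⟫ : ℝ)) * G t y ξ := by
  obtain ⟨L, h, hL⟩ := hasFDerivAt_G t y ξ
  rw [h.fderiv, hL]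

lemma differentiable_G (t : ℝ) (y : E3) : Differentiable ℝ (G t y) := fun ξ => by
  obtain ⟨L, h, -⟩ := hasFDerivAt_G t y ξ
  exact h.differentiableAt

lemma integral_G1 {t : ℝ} (ht : 0 < t) (y v : E3) :
    ∫ ξ, ((⟪ξ, v⟫ : ℝ) : ℂ) * G t y ξ = -Complex.I * (⟪y, v⟫ : ℝ) / (2 * t) * ∫ ξ, G t y ξ := by
  have i0 := integrable_G ht y
  have i1 := integrable_G1 ht y v
  have e : ∀ ξ, (1:ℂ) * fderiv ℝ (G t y) ξ v = (-2 * t : ℂ) * (((⟪ξ, v⟫ : ℝ) : ℂ) * G t y ξ)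
      - (Complex.I * (⟪y, v⟫ : ℝ)) * G t y ξ := fun ξ => by
    rw [fderiv_G]; push_cast; ring
  have h := integral_mul_fderiv_eq_neg_fderiv_mul_of_integrable (μ := (volume : Measure E3))
    (f := fun _ => (1:ℂ)) (g := G t y) (v := v) (by simp)
    (by simp_rw [e]; exact (i1.const_mul _).sub (i0.const_mul _)) (by simpa using i0)
    (fun _ _ => by fun_prop) (fun x _ => differentiable_G t y x)
  simp_rw [e] at h
  rw [integral_sub (i1.const_mul _) (i0.const_mul _), integral_const_mul, integral_const_mul] at h
  simp only [fderiv_fun_const, Pi.zero_apply, zero_apply, zero_mul,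
    integral_zero, neg_zero] at h
  have : (t:ℂ) ≠ 0 := by exact_mod_cast ht.ne'
  field_simp
  linear_combination (-1) * h

lemma integral_G2 {t : ℝ} (ht : 0 < t) (y v w : E3) :
    ∫ ξ, (((⟪ξ, v⟫ : ℝ) : ℂ) * ((⟪ξ, w⟫ : ℝ) : ℂ)) * G t y ξ =
      ((⟪v, w⟫ : ℝ) / (2 * t) - (⟪y, v⟫ : ℝ) * (⟪y, w⟫ : ℝ) / (4 * t ^ 2)) * ∫ ξ, G t y ξ := by
  have i0 := integrable_G ht y
  have i1 := integrable_G1 ht y w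
  have i2 := integrable_G2 ht y v w
  have e : ∀ ξ, ((⟪ξ, w⟫ : ℝ) : ℂ) * fderiv ℝ (G t y) ξ v =
      (-2 * t : ℂ) * ((((⟪ξ, v⟫ : ℝ) : ℂ) * ((⟪ξ, w⟫ : ℝ) : ℂ)) * G t y ξ)
      - (Complex.I * (⟪y, v⟫ : ℝ)) * (((⟪ξ, w⟫ : ℝ) : ℂ) * G t y ξ) := fun ξ => by
    rw [fderiv_G]; push_cast; ring
  have eD : ∀ ξ, fderiv ℝ (fun ξ : E3 => ((⟪ξ, w⟫ : ℝ) : ℂ)) ξ v = ((⟪v, w⟫ : ℝ) : ℂ) := fun ξ => by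
    have := (Complex.ofRealCLM.hasFDerivAt.comp ξ ((innerSL ℝ w).hasFDerivAt (x := ξ))).fderiv
    have e2 : (fun ξ : E3 => ((⟪ξ, w⟫ : ℝ) : ℂ)) = (Complex.ofRealCLM ∘ (innerSL ℝ w)) := by
      ext ξ; simp [real_inner_comm]
    rw [e2, this]
    simp [real_inner_comm]
  have h := integral_mul_fderiv_eq_neg_fderiv_mul_of_integrable (μ := (volume : Measure E3))
    (f := fun ξ => ((⟪ξ, w⟫ : ℝ) : ℂ)) (g := G t y) (v := v)
    (by simp_rw [eD]; exact i0.const_mul _)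
    (by simp_rw [e]; exact (i2.const_mul _).sub (i1.const_mul _)) i1
    (by
      have : Differentiable ℝ (fun ξ : E3 => (⟪ξ, w⟫ : ℝ)) :=
        differentiable_id.inner ℝ (differentiable_const w)
      exact fun x _ => Complex.ofRealCLM.differentiable.comp this x)
    (fun x _ => differentiable_G t y x)
  simp_rw [e, eD] at h
  rw [integral_sub (i2.const_mul _) (i1.const_mul _), integral_const_mul, integral_const_mul,
    integral_const_mul, integral_G1 ht] at h
  have : (t:ℂ) ≠ 0 := by exact_mod_cast ht.ne'
  field_simp at h ⊢
  linear_combination (-2) * h + (2 * (⟪y, v⟫ : ℝ) * (⟪y, w⟫ : ℝ) * ∫ ξ, G t y ξ) * Complex.I_sq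

lemma integral_G {t : ℝ} (ht : 0 < t) (y : E3) :
    ∫ ξ, G t y ξ = (((Real.pi / t) ^ (3 / 2 : ℝ) * Real.exp (-‖y‖ ^ 2 / (4 * t)) : ℝ) : ℂ) := by
  unfold G
  rw [GaussianFourier.integral_cexp_neg_mul_sq_norm_add (by simpa using ht)]
  have hp : 0 ≤ Real.pi / t := by positivity
  rw [Complex.ofReal_mul, Complex.ofReal_cpow hp, Complex.ofReal_exp]
  simp

/-- The quadratic form. -/
def Q (c : Matrix (Fin 3) (Fin 3) ℝ) (y : E3) : ℝ := ∑ γ, ∑ ρ, c γ ρ * y γ * y ρ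

lemma continuous_Q (c) : Continuous (Q c) := by unfold Q; fun_prop

lemma abs_Q_le (c) (y : E3) : |Q c y| ≤ (∑ γ, ∑ ρ, |c γ ρ|) * ‖y‖ ^ 2 := by
  unfold Q
  rw [Finset.sum_mul]
  refine (Finset.abs_sum_le_sum_abs _ _).trans (Finset.sum_le_sum fun i _ => ?_)
  rw [Finset.sum_mul]
  refine (Finset.abs_sum_le_sum_abs _ _).trans (Finset.sum_le_sum fun j _ => ?_)
  rw [abs_mul, abs_mul, mul_assoc, sq]
  have := PiLp.norm_apply_le y i
  have := PiLp.norm_apply_le y j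
  simp only [Real.norm_eq_abs] at *
  gcongr

lemma integral_Q_G (c : Matrix (Fin 3) (Fin 3) ℝ) (hc : c.trace = 0) {t : ℝ} (ht : 0 < t) (y : E3) :
    ∫ ξ, (Q c ξ : ℂ) * G t y ξ =
      ((-Q c y / (4 * t ^ 2) * ((Real.pi / t) ^ (3 / 2 : ℝ) *
        Real.exp (-‖y‖ ^ 2 / (4 * t))) : ℝ) : ℂ) := by
  have hin : ∀ (ξ : E3) i, ⟪ξ, EuclideanSpace.single i (1:ℝ)⟫ = ξ i := fun ξ i => by
    simp [EuclideanSpace.inner_single_right]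
  have e : ∀ ξ, (Q c ξ : ℂ) * G t y ξ = ∑ i, ∑ j, (c i j : ℂ) *
     ((((⟪ξ, EuclideanSpace.single i (1:ℝ)⟫ : ℝ) : ℂ) *
      ((⟪ξ, EuclideanSpace.single j (1:ℝ)⟫ : ℝ) : ℂ)) * G t y ξ) := fun ξ => by
    simp_rw [hin, Q]
    push_cast
    simp_rw [Finset.sum_mul]
    refine Finset.sum_congr rfl fun i _ => Finset.sum_congr rfl fun j _ => by ring
  simp_rw [e]
  have ii : ∀ i j, Integrable (fun ξ : E3 => (c i j : ℂ) *
     ((((⟪ξ, EuclideanSpace.single i (1:ℝ)⟫ : ℝ) : ℂ) *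
      ((⟪ξ, EuclideanSpace.single j (1:ℝ)⟫ : ℝ) : ℂ)) * G t y ξ)) := fun i j =>
    (integrable_G2 ht y _ _).const_mul _
  rw [integral_finsetSum _ (fun i _ => integrable_finsetSum _ fun j _ => ii i j)]
  simp_rw [integral_finsetSum _ (fun j _ => ii _ j), integral_const_mul, integral_G2 ht, hin,
    integral_G ht, Complex.ofReal_mul, ← mul_assoc, ← Finset.sum_mul]
  congr 2
  rw [Matrix.trace, Fin.sum_univ_three] at hc
  simp only [Matrix.diag] at hc
  have hcC : (c 0 0 : ℂ) + c 1 1 + c 2 2 = 0 := by exact_mod_cast hc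
  have : (t:ℂ) ≠ 0 := by exact_mod_cast ht.ne'
  simp only [Q, Fin.sum_univ_three, PiLp.single_apply]
  push_cast
  simp
  field_simp
  linear_combination (4 * t : ℂ) * hcC


/-- The (non-unitary) Fourier transform. -/
def F (φ : E3 → ℂ) (ξ : E3) : ℂ := ∫ y : E3, Complex.exp (-Complex.I * (⟪y, ξ⟫ : ℝ)) * φ y

lemma F_eq (φ : E3 → ℂ) (ξ : E3) : F φ ξ = FourierTransform.fourier φ ((2 * Real.pi)⁻¹ • ξ) := by
  rw [Real.fourier_eq', F]
  congr 1
  ext y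
  rw [smul_eq_mul, inner_smul_right]
  congr 2
  have := Real.pi_ne_zero
  have h : -2 * Real.pi * ((2 * Real.pi)⁻¹ * ⟪y, ξ⟫) = -⟪y, ξ⟫ := by field_simp
  rw [h]
  push_cast; ring

lemma F_props (φ : E3 → ℂ) (h1 : ContDiff ℝ (⊤ : ℕ∞) φ) (h2 : HasCompactSupport φ) :
    Continuous (F φ) ∧ Integrable (fun ξ => ‖ξ‖ ^ 2 * ‖F φ ξ‖) := by
  let S := FourierTransform.fourier (h2.toSchwartzMap h1)
  have hS : ∀ ξ, F φ ξ = S ((2 * Real.pi)⁻¹ • ξ) := fun ξ => by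
    rw [F_eq]; rfl
  have hp : (2 * Real.pi) ≠ 0 := by positivity
  constructor
  · rw [funext hS]
    exact S.continuous.comp (by fun_prop)
  · have := ((S.integrable_pow_mul volume 2).comp_smul (inv_ne_zero hp)).const_mul ((2*Real.pi)^2)
    refine this.congr (Filter.Eventually.of_forall fun ξ => ?_)
    simp only [hS, norm_smul, norm_inv, Real.norm_of_nonneg (show 0 ≤ 2 * Real.pi by positivity)]
    field_simp

lemma parseval (c : Matrix (Fin 3) (Fin 3) ℝ) (hc : c.trace = 0) {t : ℝ} (ht : 0 < t)
    (φ : E3 → ℂ) (hφ : Integrable φ) :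
    ∫ ξ, ((Q c ξ * Real.exp (-t * ‖ξ‖ ^ 2) : ℝ) : ℂ) * F φ ξ =
      ∫ y, ((-Q c y / (4 * t ^ 2) * ((Real.pi / t) ^ (3 / 2 : ℝ) *
        Real.exp (-‖y‖ ^ 2 / (4 * t))) : ℝ) : ℂ) * φ y := by
  have hQG : Integrable (fun ξ => (Q c ξ : ℂ) * G t 0 ξ) := by
    refine integrable_mul_G ht 0 _ (Complex.continuous_ofReal.comp (continuous_Q c))
      (∑ γ, ∑ ρ, |c γ ρ|) fun ξ => ?_
    rw [Complex.norm_real]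
    refine (abs_Q_le c ξ).trans ?_
    gcongr
    linarith
  have e1 : ∀ ξ, ((Q c ξ * Real.exp (-t * ‖ξ‖ ^ 2) : ℝ) : ℂ) * F φ ξ =
      ∫ y, (Q c ξ : ℂ) * G t y ξ * φ y := fun ξ => by
    rw [F, ← integral_const_mul]
    congr 1
    ext y
    rw [G, Complex.exp_add]
    push_cast
    ring
  have e2 : ∀ y, ((-Q c y / (4 * t ^ 2) * ((Real.pi / t) ^ (3 / 2 : ℝ) *
        Real.exp (-‖y‖ ^ 2 / (4 * t))) : ℝ) : ℂ) * φ y = ∫ ξ, (Q c ξ : ℂ) * G t y ξ * φ y := by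
    intro y
    rw [integral_mul_const, integral_Q_G c hc ht]
  simp_rw [e1, e2]
  apply integral_integral_swap
  have hb := hQG.mul_prod hφ
  refine hb.mono ?_ (Filter.Eventually.of_forall fun p => ?_)
  · refine AEStronglyMeasurable.mul ?_ hφ.aestronglyMeasurable.comp_snd
    refine Continuous.aestronglyMeasurable ?_
    have := continuous_Q c
    unfold G
    fun_prop
  · simp [Function.uncurry, norm_G]

/-- one-dimensional profile -/
def J (a : ℝ) : ℝ := ∫ u in Set.Ioi (0:ℝ), Real.exp (-(a / u)) * Real.exp (-(u / 4))

def h (a t : ℝ) : ℝ := a * (Real.exp (-t) * Real.exp (-a / (4 * t)) / t ^ 2)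

lemma int_exp : IntegrableOn (fun u : ℝ => Real.exp (-(u / 4))) (Set.Ioi 0) := by
  have := integrableOn_exp_mul_Ioi (a := -(1/4 : ℝ)) (by norm_num) 0
  refine this.congr_fun (fun x _ => ?_) measurableSet_Ioi
  simp only; ring_nf

lemma integral_exp4 : ∫ u in Set.Ioi (0:ℝ), Real.exp (-(u / 4)) = 4 := by
  have := integral_exp_mul_Ioi (a := -(1/4 : ℝ)) (by norm_num) 0
  rw [← setIntegral_congr_fun measurableSet_Ioi
    (f := fun x : ℝ => Real.exp (-(1/4 : ℝ) * x)) (fun x _ => ?_), this]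
  · norm_num
  · simp only; ring_nf

lemma J_bound {a u : ℝ} (ha : 0 ≤ a) (hu : u ∈ Set.Ioi (0:ℝ)) :
    ‖Real.exp (-(a / u)) * Real.exp (-(u / 4))‖ ≤ Real.exp (-(u / 4)) := by
  have hu : 0 < u := hu
  rw [Real.norm_of_nonneg (by positivity)]
  refine mul_le_of_le_one_left (by positivity) (Real.exp_le_one_iff.2 ?_)
  have : 0 ≤ a / u := by positivity
  linarith

lemma J_int {a : ℝ} (ha : 0 ≤ a) :
    IntegrableOn (fun u => Real.exp (-(a / u)) * Real.exp (-(u / 4))) (Set.Ioi 0) := by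
  refine Integrable.mono' int_exp ?_ ?_
  · exact Measurable.aestronglyMeasurable (by fun_prop)
  · filter_upwards [ae_restrict_mem measurableSet_Ioi] with u hu using J_bound ha hu

lemma J_nonneg (a : ℝ) : 0 ≤ J a := by
  unfold J
  exact setIntegral_nonneg measurableSet_Ioi fun u _ => by positivity

lemma J_le {a : ℝ} (ha : 0 ≤ a) : J a ≤ 4 := by
  rw [← integral_exp4]
  refine setIntegral_mono_on (J_int ha) int_exp measurableSet_Ioi fun u hu => ?_
  exact (le_abs_self _).trans (J_bound ha hu)

lemma J_zero : J 0 = 4 := by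
  rw [← integral_exp4]; simp [J]

lemma continuous_J : Continuous (fun y : E3 => J (‖y‖ ^ 2)) := by
  unfold J
  refine continuous_of_dominated (bound := fun u => Real.exp (-(u / 4))) ?_ ?_ int_exp ?_
  · exact fun y => (J_int (by positivity)).aestronglyMeasurable
  · intro y
    filter_upwards [ae_restrict_mem measurableSet_Ioi] with u hu using J_bound (by positivity) hu
  · refine Filter.Eventually.of_forall fun u => ?_
    fun_prop

lemma h_spec {a : ℝ} (ha : 0 < a) :
    IntegrableOn (h a) (Set.Ioi 0) ∧ ∫ t in Set.Ioi 0, h a t = J a := by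
  let f : ℝ → ℝ := fun t => a / t
  have him : Set.image f (Set.Ioi 0) = Set.Ioi 0 := by
    ext x
    constructor
    · rintro ⟨t, ht, rfl⟩
      exact div_pos ha ht
    · intro hx
      have hx : 0 < x := hx
      exact ⟨a / x, div_pos ha hx, by simp only [f]; field_simp⟩
  have hd : ∀ t ∈ Set.Ioi (0:ℝ), HasDerivWithinAt f (-a / t ^ 2) (Set.Ioi 0) t := by
    intro t ht
    have ht : 0 < t := ht
    have := ((hasDerivAt_inv ht.ne').const_mul a).hasDerivWithinAt (s := Set.Ioi 0)
    exact this.congr_deriv (by ring)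
  have hinj : Set.InjOn f (Set.Ioi 0) := by
    intro x hx y hy hxy
    have hx : 0 < x := hx
    have hy : 0 < y := hy
    simp only [f] at hxy
    field_simp at hxy
    exact hxy.symm
  have key : ∀ t ∈ Set.Ioi (0:ℝ), |-a / t ^ 2| • (Real.exp (-(a / f t)) * Real.exp (-(f t / 4)))
      = h a t := by
    intro t ht
    have ht : 0 < t := ht
    have e1 : a / f t = t := by simp only [f]; field_simp
    have e2 : -(f t / 4) = -a / (4 * t) := by simp only [f]; field_simp
    rw [e1, e2, h, abs_div, abs_neg, abs_of_pos ha, abs_of_pos (by positivity), smul_eq_mul]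
    ring
  constructor
  · have := (integrableOn_image_iff_integrableOn_abs_deriv_smul measurableSet_Ioi hd hinj
      (fun u => Real.exp (-(a / u)) * Real.exp (-(u / 4)))).1 (by rw [him]; exact J_int ha.le)
    exact this.congr_fun key measurableSet_Ioi
  · rw [J, ← setIntegral_congr_fun measurableSet_Ioi key,
      ← integral_image_eq_integral_abs_deriv_smul measurableSet_Ioi hd hinj
        (fun u => Real.exp (-(a / u)) * Real.exp (-(u / 4))), him]

lemma h_nonneg {a : ℝ} (ha : 0 ≤ a) (t : ℝ) : 0 ≤ h a t := by
  unfold h; positivity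

lemma h_int {a : ℝ} (ha : 0 ≤ a) : IntegrableOn (h a) (Set.Ioi 0) := by
  rcases ha.eq_or_lt with rfl | ha
  · have : h 0 = fun _ => 0 := by ext t; simp [h]
    rw [this]; exact integrableOn_zero
  · exact (h_spec ha).1

lemma Q_div_mul_integral_h (c) (y : E3) :
    Q c y / ‖y‖ ^ 2 * ∫ t in Set.Ioi 0, h (‖y‖ ^ 2) t = Q c y / ‖y‖ ^ 2 * J (‖y‖ ^ 2) := by
  rcases eq_or_ne y 0 with rfl | hy
  · simp
  · rw [(h_spec (by positivity)).2]

lemma abs_Q_div_le (c) (y : E3) : |Q c y / ‖y‖ ^ 2| ≤ ∑ γ, ∑ ρ, |c γ ρ| := by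
  rw [abs_div, abs_of_nonneg (show 0 ≤ ‖y‖ ^ 2 by positivity)]
  exact div_le_of_le_mul₀ (by positivity) (by positivity) (abs_Q_le c y)

/-- the continuous remainder -/
def kk (c : Matrix (Fin 3) (Fin 3) ℝ) (y : E3) : ℝ :=
  1 / (24 * Real.pi ^ 2) * (Q c y / ‖y‖ ^ 2 * (4 - J (‖y‖ ^ 2)))

lemma continuous_kk (c) : Continuous (kk c) := by
  refine continuous_const.mul ?_
  rw [continuous_iff_continuousAt]
  intro y
  rcases eq_or_ne y 0 with rfl | hy
  · rw [ContinuousAt]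
    have hz : Filter.Tendsto (fun y : E3 => (∑ γ, ∑ ρ, |c γ ρ|) * (4 - J (‖y‖ ^ 2))) (nhds 0)
        (nhds 0) := by
      have hJ := continuous_J
      have hcont : Continuous (fun y : E3 => (∑ γ, ∑ ρ, |c γ ρ|) * (4 - J (‖y‖ ^ 2))) := by
        fun_prop
      have := hcont.tendsto 0
      simpa [J_zero] using this
    simp only [norm_zero, ne_eq, OfNat.ofNat_ne_zero, not_false_eq_true, zero_pow, J_zero, sub_self,
      mul_zero]
    refine squeeze_zero_norm (fun y => ?_) hz
    have : 0 ≤ 4 - J (‖y‖ ^ 2) := sub_nonneg.2 (J_le (by positivity))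
    rw [norm_mul, Real.norm_of_nonneg this]
    gcongr
    exact abs_Q_div_le c y
  · refine ContinuousAt.mul ?_ (continuous_const.sub continuous_J).continuousAt
    exact (continuous_Q c).continuousAt.div (by fun_prop) (by positivity)

lemma swap_y (c) (φ : E3 → ℂ) (hφ : Integrable φ) :
    ∫ t in Set.Ioi (0:ℝ), ∫ y, ((Q c y / ‖y‖ ^ 2 * h (‖y‖ ^ 2) t : ℝ) : ℂ) * φ y =
      ∫ y, ((Q c y / ‖y‖ ^ 2 * J (‖y‖ ^ 2) : ℝ) : ℂ) * φ y := by
  have mQ : Measurable (Q c) := (continuous_Q c).measurable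
  have mJ := continuous_J.measurable
  rw [← integral_integral_swap]
  · congr 1
    ext y
    rw [integral_mul_const, integral_complex_ofReal, integral_const_mul, Q_div_mul_integral_h]
  · rw [integrable_prod_iff]
    · refine ⟨Filter.Eventually.of_forall fun y => ?_, ?_⟩
      · exact (((h_int (sq_nonneg ‖y‖)).const_mul (Q c y / ‖y‖ ^ 2)).ofReal
          (𝕜 := ℂ)).mul_const (φ y)
      · have e : ∀ y : E3, (∫ t in Set.Ioi (0:ℝ), ‖Function.uncurry (fun (y : E3) (t : ℝ) =>
            ((Q c y / ‖y‖ ^ 2 * h (‖y‖ ^ 2) t : ℝ) : ℂ) * φ y) (y, t)‖) =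
            |Q c y / ‖y‖ ^ 2| * (∫ t in Set.Ioi 0, h (‖y‖ ^ 2) t) * ‖φ y‖ := by
          intro y
          rw [← integral_const_mul, ← integral_mul_const]
          congr 1
          ext t
          simp only [Function.uncurry]
          rw [norm_mul, Complex.norm_real, norm_mul, Real.norm_of_nonneg (h_nonneg _ _),
            Real.norm_eq_abs]
          positivity
        have e2 : ∀ y : E3, |Q c y / ‖y‖ ^ 2| * (∫ t in Set.Ioi 0, h (‖y‖ ^ 2) t) =
            |Q c y / ‖y‖ ^ 2| * J (‖y‖ ^ 2) := by
          intro y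
          rcases eq_or_ne y 0 with rfl | hy
          · simp
          · rw [(h_spec (by positivity)).2]
        simp_rw [e, e2]
        refine hφ.norm.bdd_mul (c := (∑ γ, ∑ ρ, |c γ ρ|) * 4) ?_ ?_
        · exact Measurable.aestronglyMeasurable (by fun_prop)
        · refine Filter.Eventually.of_forall fun y => ?_
          rw [norm_mul, norm_abs_eq_norm, Real.norm_of_nonneg (J_nonneg _)]
          gcongr
          · exact J_nonneg _
          · exact abs_Q_div_le c y
          · exact J_le (by positivity)
    · refine AEStronglyMeasurable.mul ?_ hφ.aestronglyMeasurable.comp_fst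
      refine Measurable.aestronglyMeasurable ?_
      unfold h
      fun_prop

lemma swap_xi (c) (f : E3 → ℂ) (hf : Continuous f) (hi : Integrable (fun ξ => ‖ξ‖ ^ 2 * ‖f ξ‖)) :
    ∫ ξ, ((Q c ξ / (1 + ‖ξ‖ ^ 2) ^ ((5 : ℝ) / 2) : ℝ) : ℂ) * f ξ =
      ((1 / Real.Gamma (5 / 2) : ℝ) : ℂ) * ∫ t in Set.Ioi (0:ℝ),
        ((t ^ (3 / 2 : ℝ) * Real.exp (-t) : ℝ) : ℂ) *
        ∫ ξ, ((Q c ξ * Real.exp (-t * ‖ξ‖ ^ 2) : ℝ) : ℂ) * f ξ := by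
  have mQ : Measurable (Q c) := (continuous_Q c).measurable
  have hG : (0:ℝ) < Real.Gamma (5 / 2) := Real.Gamma_pos_of_pos (by norm_num)
  have e0 : ∀ t : ℝ, ((t ^ (3 / 2 : ℝ) * Real.exp (-t) : ℝ) : ℂ) *
        ∫ ξ, ((Q c ξ * Real.exp (-t * ‖ξ‖ ^ 2) : ℝ) : ℂ) * f ξ =
      ∫ ξ, ((t ^ (3 / 2 : ℝ) * Real.exp (-t) : ℝ) : ℂ) *
        (((Q c ξ * Real.exp (-t * ‖ξ‖ ^ 2) : ℝ) : ℂ) * f ξ) :=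
    fun t => (integral_const_mul _ _).symm
  simp_rw [e0]
  rw [← integral_integral_swap]
  · rw [← integral_const_mul]
    congr 1
    ext ξ
    have hr : (0:ℝ) < 1 + ‖ξ‖ ^ 2 := by positivity
    have key := Real.integral_rpow_mul_exp_neg_mul_Ioi (a := 5 / 2) (by norm_num) hr
    have e : ∀ t : ℝ, ((t ^ (3 / 2 : ℝ) * Real.exp (-t) : ℝ) : ℂ) *
        (((Q c ξ * Real.exp (-t * ‖ξ‖ ^ 2) : ℝ) : ℂ) * f ξ) =
        (Q c ξ * f ξ) * ((t ^ ((5 / 2 : ℝ) - 1) * Real.exp (-((1 + ‖ξ‖ ^ 2) * t)) : ℝ) : ℂ) := by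
      intro t
      rw [show -((1 + ‖ξ‖ ^ 2) * t) = -t + -t * ‖ξ‖ ^ 2 by ring, Real.exp_add]
      norm_num
      ring
    simp_rw [e]
    rw [integral_const_mul, integral_complex_ofReal, key, Real.div_rpow (by norm_num) hr.le,
      Real.one_rpow]
    have : (Real.Gamma (5 / 2) : ℂ) ≠ 0 := by exact_mod_cast hG.ne'
    push_cast
    field_simp
  · have i1 : IntegrableOn (fun t : ℝ => Real.exp (-t) * t ^ ((5 / 2 : ℝ) - 1)) (Set.Ioi 0) :=
      Real.GammaIntegral_convergent (by norm_num)
    have hb := (hi.const_mul (∑ γ, ∑ ρ, |c γ ρ|)).mul_prod i1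
    refine hb.mono' ?_ ?_
    · have := hf.measurable
      refine Measurable.aestronglyMeasurable ?_
      fun_prop
    · have : ∀ᵐ p ∂((volume : Measure E3).prod (volume.restrict (Set.Ioi (0:ℝ)))),
          p.2 ∈ Set.Ioi (0:ℝ) :=
        Measure.quasiMeasurePreserving_snd.ae (ae_restrict_mem measurableSet_Ioi)
      filter_upwards [this] with p hp
      obtain ⟨ξ, t⟩ := p
      have ht : 0 < t := hp
      simp only [Function.uncurry, norm_mul, Complex.norm_real]
      rw [Real.norm_of_nonneg (Real.exp_pos _).le, Real.norm_of_nonneg (Real.exp_pos _).le,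
        Real.norm_of_nonneg (Real.rpow_nonneg ht.le _), Real.norm_eq_abs]
      have h1 : Real.exp (-t * ‖ξ‖ ^ 2) ≤ 1 := by
        rw [Real.exp_le_one_iff]
        have : 0 ≤ t * ‖ξ‖ ^ 2 := by positivity
        linarith
      have h2 := abs_Q_le c ξ
      norm_num
      calc t ^ (3 / 2 : ℝ) * Real.exp (-t) * (|Q c ξ| * Real.exp (-(t * ‖ξ‖ ^ 2)) * ‖f ξ‖)
          ≤ t ^ (3 / 2 : ℝ) * Real.exp (-t) *
            (((∑ γ, ∑ ρ, |c γ ρ|) * ‖ξ‖ ^ 2) * 1 * ‖f ξ‖) := by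
            rw [neg_mul] at h1
            gcongr
        _ = _ := by ring

lemma Gamma52 : Real.Gamma (5 / 2) = 3 / 4 * Real.sqrt Real.pi := by
  rw [show (5 / 2 : ℝ) = 1 / 2 + 1 + 1 by norm_num, Real.Gamma_add_one (by norm_num),
    Real.Gamma_add_one (by norm_num), Real.Gamma_one_half_eq]
  ring

lemma main_aux (c : Matrix (Fin 3) (Fin 3) ℝ) (hc : c.trace = 0) (φ : E3 → ℂ)
    (h1 : ContDiff ℝ (⊤ : ℕ∞) φ) (h2 : HasCompactSupport φ) :
    (1 / (2 * Real.pi) ^ 3 : ℂ) *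
      ∫ ξ, ((Q c ξ / (1 + ‖ξ‖ ^ 2) ^ ((5 : ℝ) / 2) : ℝ) : ℂ) * F φ ξ =
    ∫ y, ((-(1 / (24 * Real.pi ^ 2)) * (Q c y / ‖y‖ ^ 2 * J (‖y‖ ^ 2)) : ℝ) : ℂ) * φ y := by
  have hφ : Integrable φ := h1.continuous.integrable_of_hasCompactSupport h2
  obtain ⟨p1, p2⟩ := F_props φ h1 h2
  rw [swap_xi c _ p1 p2]
  have e : ∀ t ∈ Set.Ioi (0:ℝ), ((t ^ (3 / 2 : ℝ) * Real.exp (-t) : ℝ) : ℂ) *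
        ∫ ξ, ((Q c ξ * Real.exp (-t * ‖ξ‖ ^ 2) : ℝ) : ℂ) * F φ ξ =
      ((-(Real.pi ^ (3 / 2 : ℝ) / 4) : ℝ) : ℂ) *
        ∫ y, ((Q c y / ‖y‖ ^ 2 * h (‖y‖ ^ 2) t : ℝ) : ℂ) * φ y := by
    intro t ht
    have ht : 0 < t := ht
    rw [parseval c hc ht φ hφ, ← integral_const_mul, ← integral_const_mul]
    congr 1
    ext y
    rw [← mul_assoc, ← Complex.ofReal_mul, ← mul_assoc (Complex.ofReal _) (Complex.ofReal _) (φ y),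
      ← Complex.ofReal_mul]
    congr 2
    rw [Real.div_rpow Real.pi_pos.le ht.le, h]
    have : (0:ℝ) < t ^ (3 / 2 : ℝ) := Real.rpow_pos_of_pos ht _
    rcases eq_or_ne y 0 with rfl | hy
    · simp [Q]
    · have : ‖y‖ ≠ 0 := by positivity
      field_simp
  rw [setIntegral_congr_fun measurableSet_Ioi e, integral_const_mul, swap_y c φ hφ,
    ← integral_const_mul, ← integral_const_mul, ← integral_const_mul]
  congr 1
  ext y
  rw [Complex.ofReal_mul (-(1 / (24 * Real.pi ^ 2)))]
  simp only [← mul_assoc]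
  congr 2
  have hs : Real.pi ^ (3 / 2 : ℝ) = Real.pi * Real.sqrt Real.pi := by
    rw [show (3 / 2 : ℝ) = 1 + 1 / 2 by norm_num, Real.rpow_add Real.pi_pos, Real.rpow_one,
      Real.sqrt_eq_rpow]
  rw [Gamma52, hs]
  have hpi := Real.pi_pos
  have : Real.sqrt Real.pi ≠ 0 := by positivity
  have key : 1 / (2 * Real.pi) ^ 3 * (1 / (3 / 4 * √Real.pi)) * (-(Real.pi * √Real.pi / 4)) =
      -(1 / (24 * Real.pi ^ 2)) := by
    field_simp
    norm_num
  rw [← key]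
  push_cast
  ring

end TS

theorem fourier_transform_traceless_symbol
    (c : Matrix (Fin 3) (Fin 3) ℝ) (hc : c.trace = 0) :
    ∃ k : EuclideanSpace ℝ (Fin 3) → ℝ, Continuous k ∧
      ∀ φ : EuclideanSpace ℝ (Fin 3) → ℂ, ContDiff ℝ (⊤ : ℕ∞) φ → HasCompactSupport φ →
        (1 / (2 * Real.pi) ^ 3 : ℂ) *
            (∫ ξ : EuclideanSpace ℝ (Fin 3),
              (((∑ γ, ∑ ρ, c γ ρ * ξ γ * ξ ρ) / (1 + ‖ξ‖ ^ 2) ^ ((5 : ℝ) / 2) : ℝ) : ℂ) *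
                ∫ y : EuclideanSpace ℝ (Fin 3),
                  Complex.exp (-Complex.I * (⟪y, ξ⟫ : ℝ)) * φ y)
          = ∫ y : EuclideanSpace ℝ (Fin 3),
              ((-(1 / (6 * Real.pi ^ 2)) * (∑ γ, ∑ ρ, c γ ρ * y γ * y ρ / ‖y‖ ^ 2)
                  + k y : ℝ) : ℂ) * φ y := by
  refine ⟨TS.kk c, TS.continuous_kk c, fun φ h1 h2 => ?_⟩
  refine (TS.main_aux c hc φ h1 h2).trans ?_
  congr 1
  ext y
  congr 2
  have e : ∑ γ, ∑ ρ, c γ ρ * y γ * y ρ / ‖y‖ ^ 2 = TS.Q c y / ‖y‖ ^ 2 := by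
    simp_rw [TS.Q, Finset.sum_div]
  rw [e, TS.kk]
  have := Real.pi_ne_zero
  field_simp
  ring
end
end
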